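/- arXiv:2209.03675 — 3 statements merged into one kernel-verified Lean document; each statement's English description precedes it below -/
import Mathlib

section
/- There is an absolute constant C > 0 such that the following holds. Let H be a graph on n vertices with a linear order on its edges, let d be its average degree, and let B be a 6 double-blocking set for H in which every edge of H appears in at most f pairs. Then the number of SCUM 3-path meets in H (with respect to the order and B) is at most C·n·d·f^3. -/
open SimpleGraph
open scoped ENNReal

noncomputable section

/-- Weighted distance in a graph: the infimum, over all walks from `u` to `v`,
of the total weight of the walk's edges (`⊤` if there is no walk). -/
def wdist {V : Type} (G : SimpleGraph V) (w : Sym2 V → ℝ≥0∞) (u v : V) : ℝ≥0∞ :=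
  ⨅ p : G.Walk u v, (p.edges.map w).sum

/-- Distance in a graph `H` whose edge `(x, y)` is (re)weighted to `δ x y`. -/
def emulDist {V : Type} (H : SimpleGraph V) (δ : V → V → ℝ≥0∞) (u v : V) : ℝ≥0∞ :=
  ⨅ p : H.Walk u v, (p.darts.map (fun d => δ d.toProd.1 d.toProd.2)).sum

/-- `H` is an `f`-edge-fault-tolerant `t`-emulator of the weighted graph `(G, w)`:
for every fault set `F ⊆ E(G)` with `|F| ≤ f`, the graph `H` with every edge `(x,y)`
reweighted to `dist_{G∖F}(x,y)` approximates all distances of `G ∖ F` within factor `t`. -/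
def IsEFTEmulator {V : Type} (G : SimpleGraph V) (w : Sym2 V → ℝ≥0∞)
    (H : SimpleGraph V) (f : ℕ) (t : ℝ≥0∞) : Prop :=
  ∀ F : Finset (Sym2 V), ↑F ⊆ G.edgeSet → F.card ≤ f →
    ∀ u v : V,
      wdist (G.deleteEdges ↑F) w u v ≤ emulDist H (wdist (G.deleteEdges ↑F) w) u v ∧
      emulDist H (wdist (G.deleteEdges ↑F) w) u v ≤ t * wdist (G.deleteEdges ↑F) w u v

/-- `e` is the last edge of the list `l` in the order given by the ranking `π`. -/
def IsLastEdge {V : Type} (π : Sym2 V → ℕ) (l : List (Sym2 V)) (e : Sym2 V) : Prop :=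
  e ∈ l ∧ ∀ e' ∈ l, π e' ≤ π e

/-- The cycle `p` is blocked by the unordered pair `b` of edges: both members of `b`
lie on `p` and one of them is the last edge of `p` in the order `π`. -/
def CycleBlockedBy {V : Type} {H : SimpleGraph V} (π : Sym2 V → ℕ) {u : V}
    (p : H.Walk u u) (b : Sym2 (Sym2 V)) : Prop :=
  ∃ e1 e2 : Sym2 V, b = s(e1, e2) ∧ e1 ∈ p.edges ∧ e2 ∈ p.edges ∧ IsLastEdge π p.edges e1

/-- `B` is a `2k` double-blocking set for `H` with edge order `π`: it consists of
unordered pairs of distinct edges of `H`, every cycle with at most `2k` edges is blocked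
by a member of `B`, and every cycle with at most `k+1` edges is blocked by two
distinct members of `B`. -/
def IsDoubleBlockingSet {V : Type} (H : SimpleGraph V) (π : Sym2 V → ℕ) (k : ℕ)
    (B : Finset (Sym2 (Sym2 V))) : Prop :=
  (∀ b ∈ B, ¬ b.IsDiag ∧ ∀ e ∈ b, e ∈ H.edgeSet) ∧
  (∀ (u : V) (p : H.Walk u u), p.IsCycle → p.length ≤ 2 * k →
      ∃ b ∈ B, CycleBlockedBy π p b) ∧
  (∀ (u : V) (p : H.Walk u u), p.IsCycle → p.length ≤ k + 1 →
      ∃ b1 ∈ B, ∃ b2 ∈ B, b1 ≠ b2 ∧ CycleBlockedBy π p b1 ∧ CycleBlockedBy π p b2)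

/-- The number of pairs of `B` containing the edge `e`. -/
def edgeBlockCount {V : Type} (B : Finset (Sym2 (Sym2 V))) (e : Sym2 V) : ℕ :=
  {b ∈ (B : Set (Sym2 (Sym2 V))) | e ∈ b}.ncard

/-- The `i`-th edge of the vertex sequence `v`. -/
def edgeOf {V : Type} {k : ℕ} (v : Fin (k + 1) → V) (i : Fin k) : Sym2 V :=
  s(v i.castSucc, v i.succ)

/-- The average degree `2|E(H)|/n` of a graph on `n` vertices. -/
def avgDeg {V : Type} [Fintype V] (H : SimpleGraph V) : ℝ :=
  2 * (H.edgeSet.ncard : ℝ) / (Fintype.card V : ℝ)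

end
noncomputable section

/-- `v` is a SCUM `k`-path (for odd `k`), viewed as an oriented sequence of `k+1`
distinct pairwise-adjacent vertices: it is simple, its middle edge (the edge with
0-indexed position `(k-1)/2`, i.e. the index `j` with `2j+1 = k`) is the last edge
of the path in the order `π`, and the two oriented subpaths starting from the middle
edge and going towards either endpoint are chain-unblocked with respect to `B`. -/
def IsSCUM {V : Type} (H : SimpleGraph V) (π : Sym2 V → ℕ) (B : Finset (Sym2 (Sym2 V)))
    (k : ℕ) (v : Fin (k + 1) → V) : Prop :=
  Function.Injective v ∧
  (∀ i : Fin k, H.Adj (v i.castSucc) (v i.succ)) ∧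
  (∀ i j : Fin k, 2 * (j : ℕ) + 1 = k → π (edgeOf v i) ≤ π (edgeOf v j)) ∧
  (∀ (i : Fin k) (j : Fin (k + 1)), 2 * (i : ℕ) + 1 ≤ k → (j : ℕ) + 1 ≤ (i : ℕ) →
      ∀ e' : Sym2 V, s(edgeOf v i, e') ∈ B → v j ∉ e') ∧
  (∀ (i : Fin k) (j : Fin (k + 1)), k ≤ 2 * (i : ℕ) + 1 → (i : ℕ) + 2 ≤ (j : ℕ) →
      ∀ e' : Sym2 V, s(edgeOf v i, e') ∈ B → v j ∉ e')

/-- The number of (oriented) SCUM `k`-paths of `H`. -/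
def scumCount {V : Type} (H : SimpleGraph V) (π : Sym2 V → ℕ)
    (B : Finset (Sym2 (Sym2 V))) (k : ℕ) : ℕ :=
  {v : Fin (k + 1) → V | IsSCUM H π B k v}.ncard

/-- The number of (oriented, aligned) SCUM `k`-path meets of `H`: pairs of distinct
SCUM `k`-paths sharing both endpoints. -/
def scumMeetCount {V : Type} (H : SimpleGraph V) (π : Sym2 V → ℕ)
    (B : Finset (Sym2 (Sym2 V))) (k : ℕ) : ℕ :=
  {vv : (Fin (k + 1) → V) × (Fin (k + 1) → V) |
    IsSCUM H π B k vv.1 ∧ IsSCUM H π B k vv.2 ∧ vv.1 ≠ vv.2 ∧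
    vv.1 0 = vv.2 0 ∧ vv.1 (Fin.last k) = vv.2 (Fin.last k)}.ncard

/-- The oriented path given by the vertex sequence `a` is chain-unblocked with
respect to `B`: for any edge `e` of the path and any vertex `x` strictly following
`e` along the path, no pair `{e, e'} ∈ B` has `e'` incident on `x`. -/
def ChainUnblockedSeq {V : Type} (B : Finset (Sym2 (Sym2 V))) {L : ℕ}
    (a : Fin (L + 1) → V) : Prop :=
  ∀ (i : Fin L) (j : Fin (L + 1)), (i : ℕ) + 2 ≤ (j : ℕ) →
    ∀ e' : Sym2 V, s(edgeOf a i, e') ∈ B → a j ∉ e'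

/-- The walk `p` is blocked: some pair of `B` has both its edges on `p`. -/
def PathBlocked {V : Type} {H : SimpleGraph V} (B : Finset (Sym2 (Sym2 V)))
    {u v : V} (p : H.Walk u v) : Prop :=
  ∃ b ∈ B, ∀ e ∈ b, e ∈ p.edges

/-- The walk `p` is double-blocked: two distinct pairs of `B` have both their edges on `p`. -/
def PathDoubleBlocked {V : Type} {H : SimpleGraph V} (B : Finset (Sym2 (Sym2 V)))
    {u v : V} (p : H.Walk u v) : Prop :=
  ∃ b1 ∈ B, ∃ b2 ∈ B, b1 ≠ b2 ∧ (∀ e ∈ b1, e ∈ p.edges) ∧ (∀ e ∈ b2, e ∈ p.edges)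

/-- The subgraph of `H` consisting of the edge `e` together with all edges
preceding it in the order `π`. -/
def subEdges {V : Type} (H : SimpleGraph V) (π : Sym2 V → ℕ) (e : Sym2 V) : SimpleGraph V :=
  SimpleGraph.fromEdgeSet {e' ∈ H.edgeSet | π e' ≤ π e}

/-- `e` is a core edge of `H` (with respect to edge order `π` and degree threshold `d/4`):
`e` survives in the graph obtained from the subgraph of edges up to `e` by iteratively
deleting vertices of degree at most `d/4`; equivalently, there is a set `S` of vertices
containing both endpoints of `e` on which the subgraph of edges up to `e` induces
a graph of minimum degree greater than `d/4`. -/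
def IsCoreEdge {V : Type} (H : SimpleGraph V) (π : Sym2 V → ℕ) (d : ℝ) (e : Sym2 V) : Prop :=
  e ∈ H.edgeSet ∧
  ∃ S : Set V, (∀ x ∈ e, x ∈ S) ∧
    ∀ v ∈ S, d / 4 < ({u ∈ S | (subEdges H π e).Adj v u}.ncard : ℝ)

end

section BlockingSets

variable {V : Type} {H : SimpleGraph V} {π : Sym2 V → ℕ} {B : Finset (Sym2 (Sym2 V))}

theorem IsLastEdge.eq_of_injOn {l : List (Sym2 V)} {e e' : Sym2 V}
    (hπ : Set.InjOn π H.edgeSet) (hl : ∀ x ∈ l, x ∈ H.edgeSet)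
    (he : IsLastEdge π l e) (he' : IsLastEdge π l e') : e = e' :=
  hπ (hl _ he.1) (hl _ he'.1) (le_antisymm (he'.2 _ he.1) (he.2 _ he'.1))

theorem CycleBlockedBy.exists_partner {k : ℕ} {u : V} {p : H.Walk u u} {b : Sym2 (Sym2 V)}
    {e : Sym2 V} (hπ : Set.InjOn π H.edgeSet) (hB : IsDoubleBlockingSet H π k B) (hb : b ∈ B)
    (h : CycleBlockedBy π p b) (he : IsLastEdge π p.edges e) :
    ∃ e' ∈ p.edges, e' ≠ e ∧ b = s(e, e') := by
  obtain ⟨e1, e2, rfl, -, h2, hlast⟩ := h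
  obtain rfl := he.eq_of_injOn hπ (fun x hx => p.edges_subset_edgeSet hx) hlast
  exact ⟨e2, h2, fun h => (hB.1 _ hb).1 (by simp [h]), rfl⟩

theorem IsDoubleBlockingSet.exists_partner {k : ℕ} {u : V} {p : H.Walk u u} {e : Sym2 V}
    (hπ : Set.InjOn π H.edgeSet) (hB : IsDoubleBlockingSet H π k B) (hp : p.IsCycle)
    (hlen : p.length ≤ 2 * k) (he : IsLastEdge π p.edges e) :
    ∃ e' ∈ p.edges, e' ≠ e ∧ s(e, e') ∈ B := by
  obtain ⟨b, hb, h⟩ := hB.2.1 u p hp hlen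
  obtain ⟨e', h1, h2, rfl⟩ := h.exists_partner hπ hB hb he
  exact ⟨e', h1, h2, hb⟩

theorem IsDoubleBlockingSet.exists_two_partners {k : ℕ} {u : V} {p : H.Walk u u} {e : Sym2 V}
    (hπ : Set.InjOn π H.edgeSet) (hB : IsDoubleBlockingSet H π k B) (hp : p.IsCycle)
    (hlen : p.length ≤ k + 1) (he : IsLastEdge π p.edges e) :
    ∃ e₁ ∈ p.edges, ∃ e₂ ∈ p.edges, e₁ ≠ e₂ ∧ e₁ ≠ e ∧ e₂ ≠ e ∧ s(e, e₁) ∈ B ∧ s(e, e₂) ∈ B := by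
  obtain ⟨b₁, hb₁, b₂, hb₂, hne, h₁, h₂⟩ := hB.2.2 u p hp hlen
  obtain ⟨e₁, h1, h1', rfl⟩ := h₁.exists_partner hπ hB hb₁ he
  obtain ⟨e₂, h2, h2', rfl⟩ := h₂.exists_partner hπ hB hb₂ he
  exact ⟨e₁, h1, e₂, h2, fun h => hne (by rw [h]), h1', h2', hb₁, hb₂⟩

/-- If `ab` is the last edge of a triangle `abc`, then it is paired with another edge at `c`. -/
theorem IsDoubleBlockingSet.exists_partner_of_triangle {a b c : V}
    (hπ : Set.InjOn π H.edgeSet) (hB : IsDoubleBlockingSet H π 3 B)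
    (hab : H.Adj a b) (hbc : H.Adj b c) (hca : H.Adj c a)
    (h1 : π s(b, c) ≤ π s(a, b)) (h2 : π s(c, a) ≤ π s(a, b)) :
    ∃ e', c ∈ e' ∧ s(s(a, b), e') ∈ B := by
  have hab' := hab.ne
  have hbc' := hbc.ne
  have hca' := hca.ne
  obtain ⟨e', he', hne, hmem⟩ := hB.exists_partner hπ
    (p := Walk.cons hab (Walk.cons hbc (Walk.cons hca Walk.nil))) (e := s(a, b))
    (by rw [Walk.cons_isCycle_iff]; simp; grind) (by simp)
    ⟨by simp, by simp [h1, h2]⟩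
  refine ⟨e', ?_, hmem⟩
  simp only [Walk.edges_cons, Walk.edges_nil, List.mem_cons, List.not_mem_nil, or_false] at he'
  rcases he' with rfl | rfl | rfl <;> simp_all

/-- If `ab` is the last edge of a 4-cycle `abcd`, then it is paired with an edge of the
cycle incident to `c`. -/
theorem IsDoubleBlockingSet.exists_partner_of_square {a b c d : V}
    (hπ : Set.InjOn π H.edgeSet) (hB : IsDoubleBlockingSet H π 3 B)
    (hab : H.Adj a b) (hbc : H.Adj b c) (hcd : H.Adj c d) (hda : H.Adj d a)
    (hac : a ≠ c) (hbd : b ≠ d)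
    (h1 : π s(b, c) ≤ π s(a, b)) (h2 : π s(c, d) ≤ π s(a, b)) (h3 : π s(d, a) ≤ π s(a, b)) :
    s(s(a, b), s(b, c)) ∈ B ∨ s(s(a, b), s(c, d)) ∈ B := by
  have hab' := hab.ne
  have hbc' := hbc.ne
  have hcd' := hcd.ne
  have hda' := hda.ne
  obtain ⟨e₁, he₁, e₂, he₂, hne, hne₁, hne₂, hmem₁, hmem₂⟩ := hB.exists_two_partners hπ
    (p := Walk.cons hab (Walk.cons hbc (Walk.cons hcd (Walk.cons hda Walk.nil)))) (e := s(a, b))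
    (by rw [Walk.cons_isCycle_iff]; simp; grind) (by simp)
    ⟨by simp, by simp [h1, h2, h3]⟩
  simp only [Walk.edges_cons, Walk.edges_nil, List.mem_cons, List.not_mem_nil, or_false] at he₁ he₂
  grind

theorem IsDoubleBlockingSet.exists_partner_of_hexagon {a b c d e f : V}
    (hπ : Set.InjOn π H.edgeSet) (hB : IsDoubleBlockingSet H π 3 B)
    (hab : H.Adj a b) (hbc : H.Adj b c) (hcd : H.Adj c d) (hde : H.Adj d e) (hef : H.Adj e f)
    (hfa : H.Adj f a) (hnd : [a, b, c, d, e, f].Nodup)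
    (hlast : ∀ x ∈ [s(b, c), s(c, d), s(d, e), s(e, f), s(f, a)], π x ≤ π s(a, b)) :
    ∃ x ∈ [s(b, c), s(c, d), s(d, e), s(e, f), s(f, a)], s(s(a, b), x) ∈ B := by
  obtain ⟨x, hx, hne, hmem⟩ := hB.exists_partner hπ
    (p := Walk.cons hab (Walk.cons hbc (Walk.cons hcd (Walk.cons hde (Walk.cons hef
      (Walk.cons hfa Walk.nil)))))) (e := s(a, b))
    (by rw [Walk.cons_isCycle_iff]; simp at hnd ⊢; grind) (by simp)
    ⟨by simp, by simpa using hlast⟩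
  simp only [Walk.edges_cons, Walk.edges_nil, List.mem_cons, List.not_mem_nil, or_false] at hx
  exact ⟨x, by simpa [hne] using hx, hmem⟩

/-- A SCUM `3`-path with vertices `a, b, c, d`. -/
structure IsScumThree (H : SimpleGraph V) (π : Sym2 V → ℕ) (B : Finset (Sym2 (Sym2 V)))
    (a b c d : V) : Prop where
  nodup : [a, b, c, d].Nodup
  adj₁ : H.Adj a b
  adj₂ : H.Adj b c
  adj₃ : H.Adj c d
  le₁ : π s(a, b) ≤ π s(b, c)
  le₃ : π s(c, d) ≤ π s(b, c)
  notMem₁ : ∀ e', s(s(b, c), e') ∈ B → a ∉ e'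
  notMem₃ : ∀ e', s(s(b, c), e') ∈ B → d ∉ e'

theorem IsSCUM.isScumThree {v : Fin 4 → V} (h : IsSCUM H π B 3 v) :
    IsScumThree H π B (v 0) (v 1) (v 2) (v 3) where
  nodup := by simp [h.1.eq_iff]
  adj₁ := h.2.1 0
  adj₂ := h.2.1 1
  adj₃ := h.2.1 2
  le₁ := h.2.2.1 0 1 (by simp)
  le₃ := h.2.2.1 2 1 (by simp)
  notMem₁ := h.2.2.2.1 1 0 (by simp) (by simp)
  notMem₃ := h.2.2.2.2 1 3 (by simp) (by simp)

namespace IsScumThree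

variable {a b c d b' c' : V}

theorem reverse (h : IsScumThree H π B a b c d) : IsScumThree H π B d c b a where
  nodup := by have := h.nodup; simp at this ⊢; grind
  adj₁ := h.adj₃.symm
  adj₂ := h.adj₂.symm
  adj₃ := h.adj₁.symm
  le₁ := by simpa [Sym2.eq_swap] using h.le₃
  le₃ := by simpa [Sym2.eq_swap] using h.le₁
  notMem₁ := by simpa [Sym2.eq_swap (a := c)] using h.notMem₃
  notMem₃ := by simpa [Sym2.eq_swap (a := c)] using h.notMem₁

/-- The last edge of a SCUM `3`-path `abcd` is not the last edge of a triangle `bcd`. -/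
theorem lt_of_adj (hπ : Set.InjOn π H.edgeSet) (hB : IsDoubleBlockingSet H π 3 B)
    (h : IsScumThree H π B a b c d) (hdb : H.Adj d b) : π s(b, c) < π s(d, b) := by
  by_contra! hle
  obtain ⟨e', he', hmem⟩ :=
    hB.exists_partner_of_triangle hπ h.adj₂ h.adj₃ hdb h.le₃ hle
  exact h.notMem₃ _ hmem he'

theorem third_eq (hπ : Set.InjOn π H.edgeSet) (hB : IsDoubleBlockingSet H π 3 B)
    (h : IsScumThree H π B a b c d) (h' : IsScumThree H π B a b c' d) : c = c' := by
  by_contra hne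
  wlog hle : π s(b, c') ≤ π s(b, c) generalizing c c'
  · exact this h' h (Ne.symm hne) (le_of_not_ge hle)
  have hbd : b ≠ d := by have := h.nodup; simp at this; grind
  rcases hB.exists_partner_of_square hπ h.adj₂ h.adj₃ h'.adj₃.symm h'.adj₂.symm hbd hne h.le₃
    (by simpa [Sym2.eq_swap] using h'.le₃.trans hle) (by simpa [Sym2.eq_swap] using hle)
    with hmem | hmem
  · exact h.notMem₃ _ hmem (by simp)
  · exact h.notMem₃ _ hmem (by simp)

theorem second_ne_third (hπ : Set.InjOn π H.edgeSet) (hB : IsDoubleBlockingSet H π 3 B)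
    (h : IsScumThree H π B a b c d) (h' : IsScumThree H π B a b' c' d) : b ≠ c' := by
  rintro rfl
  have h1 := h.lt_of_adj hπ hB h'.adj₃.symm
  have h2 := h'.reverse.lt_of_adj hπ hB h.adj₁
  have h3 := h'.le₃
  have h4 := h.le₁
  rw [Sym2.eq_swap (a := d)] at h1
  rw [Sym2.eq_swap (a := b) (b := b')] at h2
  omega

theorem disjoint_of_meet (hπ : Set.InjOn π H.edgeSet) (hB : IsDoubleBlockingSet H π 3 B)
    (h : IsScumThree H π B a b c d) (h' : IsScumThree H π B a b' c' d)
    (hne : ¬ (b = b' ∧ c = c')) : b ≠ b' ∧ c ≠ c' ∧ b ≠ c' ∧ c ≠ b' := by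
  refine ⟨?_, ?_, h.second_ne_third hπ hB h', (h'.second_ne_third hπ hB h).symm⟩
  · rintro rfl
    exact hne ⟨rfl, h.third_eq hπ hB h'⟩
  · rintro rfl
    exact hne ⟨h.reverse.third_eq hπ hB h'.reverse, rfl⟩

theorem mem_of_meet (hπ : Set.InjOn π H.edgeSet) (hB : IsDoubleBlockingSet H π 3 B)
    (h : IsScumThree H π B a b c d) (h' : IsScumThree H π B a b' c' d)
    (hne : ¬ (b = b' ∧ c = c')) : s(s(b, c), s(b', c')) ∈ B := by
  wlog hle : π s(b', c') ≤ π s(b, c) generalizing b c b' c'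
  · rw [Sym2.eq_swap]
    exact this h' h (by grind) (le_of_not_ge hle)
  obtain ⟨h1, h2, h3, h4⟩ := h.disjoint_of_meet hπ hB h' hne
  have hn := h.nodup
  have hn' := h'.nodup
  have hle₁ := h.le₁
  have hle₃ := h.le₃
  have hle₁' := h'.le₁
  have hle₃' := h'.le₃
  obtain ⟨x, hx, hmem⟩ := hB.exists_partner_of_hexagon hπ h.adj₂ h.adj₃ h'.adj₃.symm
    h'.adj₂.symm h'.adj₁.symm h.adj₁ (by simp at hn hn' ⊢; grind)
    (by
      simp only [Sym2.eq_swap (a := d) (b := c'), Sym2.eq_swap (a := c') (b := b'),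
        Sym2.eq_swap (a := b') (b := a), List.forall_mem_cons]
      exact ⟨by omega, by omega, by omega, by omega, by omega, by simp⟩)
  have ha := h.notMem₁ _ hmem
  have hd := h.notMem₃ _ hmem
  rw [Sym2.eq_swap (a := b') (b := c')]
  simp only [List.mem_cons, List.not_mem_nil, or_false] at hx
  rcases hx with rfl | rfl | rfl | rfl | rfl <;> simp_all

end IsScumThree

end BlockingSets

section Counting

variable {V : Type} {H : SimpleGraph V} {π : Sym2 V → ℕ} {B : Finset (Sym2 (Sym2 V))}

open Classical in
theorem card_le_edgeBlockCount {e : Sym2 V} (X : Finset (Sym2 V))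
    (hX : ∀ e' ∈ X, s(e, e') ∈ B) : X.card ≤ edgeBlockCount B e := by
  rw [edgeBlockCount, ← Set.ncard_coe_finset]
  refine Set.ncard_le_ncard_of_injOn (fun e' => s(e, e')) (fun e' he' => ⟨hX _ he', by simp⟩)
    (fun x _ y _ hxy => Sym2.congr_right.1 hxy) (B.finite_toSet.subset fun b hb => hb.1)

open Classical in
theorem card_filter_mk_mem_le [Fintype V] (X : Finset (Sym2 V)) :
    (Finset.univ.filter fun p : V × V => s(p.1, p.2) ∈ X).card ≤ 2 * X.card := by
  refine Finset.card_le_mul_card_image_of_maps_to (f := fun p : V × V => s(p.1, p.2))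
    (fun p hp => by simpa using hp) 2 fun e _ => ?_
  induction e with | h a b => ?_
  refine (Finset.card_le_card (t := {(a, b), (b, a)}) fun p hp => ?_).trans Finset.card_le_two
  simp at hp ⊢
  grind

open Classical in
theorem card_commonNeighbors_le_of_last [Fintype V] {f : ℕ} {a c x : V}
    (hπ : Set.InjOn π H.edgeSet) (hB : IsDoubleBlockingSet H π 3 B)
    (hf : ∀ e ∈ H.edgeSet, edgeBlockCount B e ≤ f) (hac : a ≠ c)
    (hax : H.Adj a x) (hcx : H.Adj c x)
    (h : ∀ y, H.Adj a y → H.Adj c y → π s(a, y) ≤ π s(a, x) ∧ π s(c, y) ≤ π s(a, x)) :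
    (Finset.univ.filter fun y => H.Adj a y ∧ H.Adj c y).card ≤ f + 1 := by
  set X := Finset.univ.filter fun y => H.Adj a y ∧ H.Adj c y
  have key : ∀ y ∈ X.erase x, ∃ e', y ∈ e' ∧ (a ∈ e' ∨ c ∈ e') ∧ s(s(a, x), e') ∈ B := by
    intro y hy
    simp only [X, Finset.mem_erase, Finset.mem_filter, Finset.mem_univ, true_and] at hy
    obtain ⟨hyx, hay, hcy⟩ := hy
    have h1 := (h x hax hcx).2
    have h2 := (h y hay hcy).1
    have h3 := (h y hay hcy).2
    rcases hB.exists_partner_of_square hπ hax.symm hay hcy.symm hcx hyx.symm hac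
      (by simpa [Sym2.eq_swap (a := x)] using h2)
      (by simpa [Sym2.eq_swap (a := x), Sym2.eq_swap (a := y)] using h3)
      (by simpa [Sym2.eq_swap (a := x)] using h1) with hm | hm
    · exact ⟨s(a, y), by simp, by simp, by rwa [Sym2.eq_swap (a := a) (b := x)]⟩
    · exact ⟨s(y, c), by simp, by simp, by rwa [Sym2.eq_swap (a := a) (b := x)]⟩
  have : Nonempty (Sym2 V) := ⟨s(a, x)⟩
  choose! g hg₁ hg₂ hg₃ using key
  have hinj : ∀ y ∈ X.erase x, ∀ z ∈ X.erase x, g y = g z → y = z := by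
    intro y hy z hz hyz
    have hy₁ := hg₁ y hy
    have hz₁ := hg₁ z hz
    have hy₂ := hg₂ y hy
    rw [← hyz] at hz₁
    simp only [X, Finset.mem_erase, Finset.mem_filter, Finset.mem_univ, true_and] at hy hz
    have := hy.2.1.ne
    have := hy.2.2.ne
    have := hz.2.1.ne
    have := hz.2.2.ne
    generalize g y = e at *
    induction e with | h p q => ?_
    simp only [Sym2.mem_iff] at hy₁ hz₁ hy₂
    grind
  have h1 := card_le_edgeBlockCount (B := B) (e := s(a, x)) ((X.erase x).image g)
    (Finset.forall_mem_image.2 hg₃)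
  rw [Finset.card_image_of_injOn fun y hy z hz => hinj y hy z hz] at h1
  have h2 := hf s(a, x) hax
  have h3 := X.pred_card_le_card_erase (a := x)
  omega

open Classical in
theorem card_commonNeighbors_le [Fintype V] {f : ℕ} {a c : V}
    (hπ : Set.InjOn π H.edgeSet) (hB : IsDoubleBlockingSet H π 3 B)
    (hf : ∀ e ∈ H.edgeSet, edgeBlockCount B e ≤ f) (hac : a ≠ c) :
    (Finset.univ.filter fun y => H.Adj a y ∧ H.Adj c y).card ≤ f + 1 := by
  set X := Finset.univ.filter fun y => H.Adj a y ∧ H.Adj c y with hX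
  rcases X.eq_empty_or_nonempty with h | h
  · simp [h]
  obtain ⟨x, hx, hmax⟩ := X.exists_max_image (fun y => max (π s(a, y)) (π s(c, y))) h
  simp only [X, Finset.mem_filter, Finset.mem_univ, true_and, and_imp] at hx hmax
  rcases le_total (π s(c, x)) (π s(a, x)) with hle | hle
  · refine card_commonNeighbors_le_of_last hπ hB hf hac hx.1 hx.2 fun y h1 h2 => ?_
    have := hmax y h1 h2
    omega
  · simp only [hX, and_comm (a := H.Adj a _)]
    refine card_commonNeighbors_le_of_last hπ hB hf hac.symm hx.2 hx.1 fun y h1 h2 => ?_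
    have := hmax y h2 h1
    omega

open Classical in
theorem card_filter_pair_mem_le [Fintype V] {k f : ℕ} (hB : IsDoubleBlockingSet H π k B)
    (hf : ∀ e ∈ H.edgeSet, edgeBlockCount B e ≤ f) :
    (Finset.univ.filter fun q : (V × V) × (V × V) =>
      s(s(q.1.1, q.1.2), s(q.2.1, q.2.2)) ∈ B).card ≤ 2 * f * (2 * H.edgeSet.ncard) := by
  have hE : (Finset.univ.filter fun p : V × V => s(p.1, p.2) ∈ H.edgeFinset).card
      ≤ 2 * H.edgeSet.ncard := by
    simpa [Set.ncard_eq_toFinset_card', SimpleGraph.edgeFinset] using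
      card_filter_mk_mem_le H.edgeFinset
  refine le_trans ?_ (Nat.mul_le_mul_left _ hE)
  refine Finset.card_le_mul_card_image_of_maps_to (f := Prod.fst) ?_ _ ?_
  · intro q hq
    have := (hB.1 _ (Finset.mem_filter.1 hq).2).2 s(q.1.1, q.1.2) (by simp)
    simpa using this
  · rintro p hp
    have hp' : s(p.1, p.2) ∈ H.edgeSet := by simpa using hp
    set X := Finset.univ.filter fun e' => s(s(p.1, p.2), e') ∈ B
    have hX : X.card ≤ f := (card_le_edgeBlockCount X (by simp [X])).trans (hf _ hp')
    refine le_trans ?_ ((card_filter_mk_mem_le X).trans (Nat.mul_le_mul_left _ hX))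
    refine Finset.card_le_card_of_injOn Prod.snd ?_ ?_
    · intro q hq
      simp only [Finset.coe_filter, Finset.mem_filter, Finset.mem_univ, true_and,
        Set.mem_ofPred_eq, X] at hq ⊢
      obtain ⟨hq, rfl⟩ := hq
      exact hq
    · intro q hq r hr hqr
      simp only [Finset.coe_filter, Set.mem_ofPred_eq] at hq hr
      exact Prod.ext (hq.2.trans hr.2.symm) hqr

open Classical in
theorem scumMeetCount_three_le [Fintype V] {f : ℕ}
    (hπ : Set.InjOn π H.edgeSet) (hB : IsDoubleBlockingSet H π 3 B)
    (hf : ∀ e ∈ H.edgeSet, edgeBlockCount B e ≤ f) :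
    scumMeetCount H π B 3 ≤ (f + 1) * (f + 1) * (2 * f * (2 * H.edgeSet.ncard)) := by
  refine le_trans ?_ (Nat.mul_le_mul_left _ (card_filter_pair_mem_le hB hf))
  rw [scumMeetCount, Set.ncard_eq_toFinset_card']
  have hmeet : ∀ vv : (Fin 4 → V) × (Fin 4 → V), IsSCUM H π B 3 vv.1 ∧ IsSCUM H π B 3 vv.2 ∧
      vv.1 ≠ vv.2 ∧ vv.1 0 = vv.2 0 ∧ vv.1 (Fin.last 3) = vv.2 (Fin.last 3) →
      IsScumThree H π B (vv.1 0) (vv.1 1) (vv.1 2) (vv.1 3) ∧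
      IsScumThree H π B (vv.1 0) (vv.2 1) (vv.2 2) (vv.1 3) ∧
      ¬ (vv.1 1 = vv.2 1 ∧ vv.1 2 = vv.2 2) := by
    rintro ⟨v, w⟩ ⟨hv, hw, hne, h0, h3⟩
    change v 3 = w 3 at h3
    have hw' := hw.isScumThree
    dsimp only at *
    rw [← h0, ← h3] at hw'
    refine ⟨hv.isScumThree, hw', fun h => hne ?_⟩
    ext i
    fin_cases i <;> simp [h0, h3, h.1, h.2]
  refine Finset.card_le_mul_card_image_of_maps_to
    (f := fun vv : (Fin 4 → V) × (Fin 4 → V) => ((vv.1 1, vv.1 2), (vv.2 1, vv.2 2))) ?_ _ ?_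
  · intro vv hvv
    obtain ⟨hv, hw, hne⟩ := hmeet vv (by simpa using hvv)
    simpa using hv.mem_of_meet hπ hB hw hne
  · rintro ⟨⟨b, c⟩, ⟨b', c'⟩⟩ -
    by_cases hbc : b ≠ b' ∧ c ≠ c'
    swap
    · rw [Finset.card_eq_zero.2]
      · exact Nat.zero_le _
      refine Finset.filter_eq_empty_iff.2 fun vv hvv heq => hbc ?_
      obtain ⟨hv, hw, hne⟩ := hmeet vv (by simpa using hvv)
      have := hv.disjoint_of_meet hπ hB hw hne
      simp only [Prod.mk.injEq] at heq
      grind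
    refine le_trans (Finset.card_le_card_of_injOn (t :=
      (Finset.univ.filter fun y => H.Adj b y ∧ H.Adj b' y) ×ˢ
      (Finset.univ.filter fun y => H.Adj c y ∧ H.Adj c' y)) (fun vv => (vv.1 0, vv.1 3)) ?_ ?_) ?_
    · intro vv hvv
      simp only [Finset.coe_filter, Set.mem_ofPred_eq, Prod.mk.injEq] at hvv
      obtain ⟨hvv, ⟨rfl, rfl⟩, rfl, rfl⟩ := hvv
      obtain ⟨hv, hw, -⟩ := hmeet vv (by simpa using hvv)
      simp [hv.adj₁.symm, hw.adj₁.symm, hv.adj₃, hw.adj₃]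
    · rintro ⟨v, w⟩ hvw ⟨v', w'⟩ hvw' heq
      simp only [Finset.coe_filter, Set.mem_ofPred_eq, Prod.mk.injEq, Set.mem_toFinset]
        at hvw hvw' heq
      obtain ⟨⟨-, -, -, h0, h3⟩, ⟨h4, h5⟩, h6, h7⟩ := hvw
      obtain ⟨⟨-, -, -, h0', h3'⟩, ⟨h4', h5'⟩, h6', h7'⟩ := hvw'
      change v 3 = w 3 at h3
      change v' 3 = w' 3 at h3'
      refine Prod.ext ?_ ?_ <;> ext i <;> fin_cases i <;> simp <;> grind
    · rw [Finset.card_product]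
      exact Nat.mul_le_mul (card_commonNeighbors_le hπ hB hf hbc.1)
        (card_commonNeighbors_le hπ hB hf hbc.2)

end Counting

/-- There is an absolute constant `C > 0` such that: if `H` is a graph on
`n` vertices with a linear order on its edges and average degree `d`, and `B` is a `6`
double-blocking set for `H` in which every edge of `H` appears in at most `f` pairs,
then the number of SCUM `3`-path meets in `H` is at most `C·n·d·f^3`. -/
theorem statement_11 :
    ∃ C : ℝ, 0 < C ∧
      ∀ (V : Type) [Fintype V], ∀ (H : SimpleGraph V) (π : Sym2 V → ℕ)
        (B : Finset (Sym2 (Sym2 V))) (f : ℕ),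
        Set.InjOn π H.edgeSet →
        IsDoubleBlockingSet H π 3 B →
        (∀ e ∈ H.edgeSet, edgeBlockCount B e ≤ f) →
        (scumMeetCount H π B 3 : ℝ) ≤
          C * (Fintype.card V : ℝ) * avgDeg H * (f : ℝ) ^ 3 := by
  refine ⟨8, by norm_num, fun V _ H π B f hπ hB hf => ?_⟩
  have hcount : scumMeetCount H π B 3 ≤ 16 * H.edgeSet.ncard * f ^ 3 := by
    refine (scumMeetCount_three_le hπ hB hf).trans ?_
    rcases Nat.eq_zero_or_pos f with rfl | hpos
    · simp
    · calc (f + 1) * (f + 1) * (2 * f * (2 * H.edgeSet.ncard))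
          ≤ (f + f) * (f + f) * (2 * f * (2 * H.edgeSet.ncard)) := by gcongr <;> omega
        _ = 16 * H.edgeSet.ncard * f ^ 3 := by ring
  have hdeg : (Fintype.card V : ℝ) * avgDeg H = 2 * H.edgeSet.ncard := by
    rcases isEmpty_or_nonempty V with hV | hV
    · have : H.edgeSet = ∅ := by
        refine Set.eq_empty_of_forall_notMem fun e _ => ?_
        induction e with | h a b => exact hV.elim a
      simp [avgDeg, this]
    · have : (Fintype.card V : ℝ) ≠ 0 := by simp
      rw [avgDeg]
      field_simp
  rw [mul_assoc 8, hdeg]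
  calc (scumMeetCount H π B 3 : ℝ) ≤ ((16 * H.edgeSet.ncard * f ^ 3 : ℕ) : ℝ) := by
        exact_mod_cast hcount
    _ = 8 * (2 * H.edgeSet.ncard) * (f : ℝ) ^ 3 := by push_cast; ring
end

section
/- For every odd positive integer k and every constant β > 0 there is a constant C > 0 (depending only on k and β) such that the following holds. Let H be a graph on n vertices with a linear order on its edges, let d be its average degree, suppose every vertex of H has degree at most β·d, and let B be a 2k double-blocking set for H in which every edge of H appears in at most f pairs. Then the number of SCUM k-path meets in H (with respect to the order and B) is at most C·(n·f^k·d^{k−2} + n·f^{(k+1)/2}·d^{k−1}). -/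
open SimpleGraph
open scoped ENNReal

/-! ### Cycles formed by two sequences with common ends -/

/-- The `i`-th edge of a vertex sequence indexed by `ℕ`. -/
def seqEdge {V : Type} (x : ℕ → V) (i : ℕ) : Sym2 V := s(x i, x (i + 1))

theorem reachable_of_seq {V : Type} {G : SimpleGraph V} (x : ℕ → V) {a b : ℕ} (hab : a ≤ b)
    (h : ∀ s, a ≤ s → s < b → G.Adj (x s) (x (s + 1))) : G.Reachable (x a) (x b) := by
  induction b, hab using Nat.le_induction with
  | base => exact Reachable.refl _
  | succ b hb ih =>
    exact (ih fun s h1 h2 => h s h1 (by omega)).trans (h b hb (by omega)).reachable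

theorem exists_isCycle_of_reachable {V : Type} {H : SimpleGraph V} {E : Finset (Sym2 V)}
    (hE : ↑E ⊆ H.edgeSet) {u v : V} (he : s(u, v) ∈ E)
    (hr : (fromEdgeSet ((E : Set (Sym2 V)) \ {s(u, v)})).Reachable u v) :
    ∃ (w : V) (c : H.Walk w w), c.IsCycle ∧ s(u, v) ∈ c.edges ∧ (∀ e ∈ c.edges, e ∈ E) ∧
      c.length ≤ E.card := by
  classical
  have hle : fromEdgeSet (E : Set (Sym2 V)) ≤ H := by
    intro x y hxy
    exact hE ((fromEdgeSet_adj _).1 hxy).1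
  have hadj : (fromEdgeSet (E : Set (Sym2 V))).Adj u v :=
    (fromEdgeSet_adj _).2 ⟨he, (H.ne_of_adj (hE he))⟩
  have hr' : ((fromEdgeSet (E : Set (Sym2 V))).deleteEdges {s(u, v)}).Reachable u v := by
    refine hr.mono ?_
    intro x y hxy
    simp only [fromEdgeSet_adj, deleteEdges_adj, Set.mem_sdiff] at hxy ⊢
    tauto
  obtain ⟨w, c, hc, hmem⟩ := adj_and_reachable_delete_edges_iff_exists_cycle.1 ⟨hadj, hr'⟩
  have hsub : ∀ e ∈ c.edges, e ∈ E := by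
    intro e hec
    have := c.edges_subset_edgeSet hec
    rw [edgeSet_fromEdgeSet] at this
    exact_mod_cast this.1
  refine ⟨w, c.mapLe hle, hc.mapLe hle, ?_, ?_, ?_⟩
  · rwa [Walk.edges_mapLe_eq_edges]
  · rwa [Walk.edges_mapLe_eq_edges]
  · rw [Walk.mapLe, Walk.length_map, ← Walk.length_edges,
      ← List.toFinset_card_of_nodup hc.edges_nodup]
    exact Finset.card_le_card fun e he => hsub e (List.mem_toFinset.1 he)

/-- The edges of `x` on `[a, b]` together with those of `y` on `[c, d]`. -/
def pairEdges {V : Type} [DecidableEq V] (x y : ℕ → V) (a b c d : ℕ) : Finset (Sym2 V) :=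
  (Finset.Ico a b).image (seqEdge x) ∪ (Finset.Ico c d).image (seqEdge y)

theorem mem_pairEdges {V : Type} [DecidableEq V] {x y : ℕ → V} {a b c d : ℕ} {e : Sym2 V} :
    e ∈ pairEdges x y a b c d ↔
      (∃ s, a ≤ s ∧ s < b ∧ seqEdge x s = e) ∨ (∃ s, c ≤ s ∧ s < d ∧ seqEdge y s = e) := by
  simp [pairEdges, and_assoc]

theorem exists_isCycle_of_seqs {V : Type} [DecidableEq V] {H : SimpleGraph V} {x y : ℕ → V}
    {a b c d t : ℕ}
    (hx : ∀ s, a ≤ s → s < b → H.Adj (x s) (x (s + 1)))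
    (hy : ∀ s, c ≤ s → s < d → H.Adj (y s) (y (s + 1)))
    (hcd : c ≤ d) (hat : a ≤ t) (htb : t < b) (h0 : x a = y c) (h1 : x b = y d)
    (hxt : ∀ s, a ≤ s → s < b → s ≠ t → seqEdge x s ≠ seqEdge x t)
    (hyt : ∀ s, c ≤ s → s < d → seqEdge y s ≠ seqEdge x t) :
    ∃ (w : V) (p : H.Walk w w), p.IsCycle ∧ seqEdge x t ∈ p.edges ∧
      (∀ e ∈ p.edges, e ∈ pairEdges x y a b c d) ∧ p.length ≤ (b - a) + (d - c) := by
  have hE : ((pairEdges x y a b c d : Finset (Sym2 V)) : Set (Sym2 V)) ⊆ H.edgeSet := by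
    intro e he
    rcases mem_pairEdges.1 he with ⟨s, h1, h2, rfl⟩ | ⟨s, h1, h2, rfl⟩
    · exact hx s h1 h2
    · exact hy s h1 h2
  have adjx : ∀ s, a ≤ s → s < b → s ≠ t →
      (fromEdgeSet ((pairEdges x y a b c d : Set (Sym2 V)) \ {s(x t, x (t + 1))})).Adj
        (x s) (x (s + 1)) := fun s hs1 hs2 hs3 =>
    (fromEdgeSet_adj _).2 ⟨⟨mem_pairEdges.2 (Or.inl ⟨s, hs1, hs2, rfl⟩), hxt s hs1 hs2 hs3⟩,
      (hx s hs1 hs2).ne⟩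
  have adjy : ∀ s, c ≤ s → s < d →
      (fromEdgeSet ((pairEdges x y a b c d : Set (Sym2 V)) \ {s(x t, x (t + 1))})).Adj
        (y s) (y (s + 1)) := fun s hs1 hs2 =>
    (fromEdgeSet_adj _).2 ⟨⟨mem_pairEdges.2 (Or.inr ⟨s, hs1, hs2, rfl⟩), hyt s hs1 hs2⟩,
      (hy s hs1 hs2).ne⟩
  have r1 := reachable_of_seq x hat fun s hs1 hs2 => adjx s hs1 (by omega) (by omega)
  have r2 := reachable_of_seq y hcd adjy
  have r3 := reachable_of_seq x (show t + 1 ≤ b by omega)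
    fun s hs1 hs2 => adjx s (by omega) hs2 (by omega)
  rw [← h0, ← h1] at r2
  obtain ⟨w, p, hp, hm, hsub, hlen⟩ := exists_isCycle_of_reachable hE
    (mem_pairEdges.2 (Or.inl ⟨t, hat, htb, rfl⟩)) (r1.symm.trans (r2.trans r3.symm))
  refine ⟨w, p, hp, hm, hsub, hlen.trans ?_⟩
  refine (Finset.card_union_le _ _).trans (Nat.add_le_add ?_ ?_)
  · exact Finset.card_image_le.trans (by simp)
  · exact Finset.card_image_le.trans (by simp)

theorem CycleBlockedBy.exists_of_last {V : Type} {H : SimpleGraph V} {π : Sym2 V → ℕ}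
    (hπ : Set.InjOn π H.edgeSet) {w : V} {p : H.Walk w w} {e : Sym2 V}
    (he : IsLastEdge π p.edges e) {b : Sym2 (Sym2 V)} (hb : CycleBlockedBy π p b) :
    ∃ e' ∈ p.edges, b = s(e, e') := by
  obtain ⟨e1, e2, rfl, h1, h2, h3⟩ := hb
  have : e1 = e := hπ (p.edges_subset_edgeSet h1) (p.edges_subset_edgeSet he.1)
    (le_antisymm (he.2 _ h1) (h3.2 _ he.1))
  subst this
  exact ⟨e2, h2, rfl⟩

/-- If two sequences have common ends, and an edge of the first one that is not on the second
one is the last edge of their union, then it is blocked by some edge of the union. -/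
theorem IsDoubleBlockingSet.exists_block {V : Type} [DecidableEq V] {H : SimpleGraph V}
    {π : Sym2 V → ℕ} {k : ℕ} {B : Finset (Sym2 (Sym2 V))} (hB : IsDoubleBlockingSet H π k B)
    (hπ : Set.InjOn π H.edgeSet) {x y : ℕ → V} {a b c d t : ℕ}
    (hx : ∀ s, a ≤ s → s < b → H.Adj (x s) (x (s + 1)))
    (hy : ∀ s, c ≤ s → s < d → H.Adj (y s) (y (s + 1)))
    (hcd : c ≤ d) (hat : a ≤ t) (htb : t < b) (h0 : x a = y c) (h1 : x b = y d)
    (hxt : ∀ s, a ≤ s → s < b → s ≠ t → seqEdge x s ≠ seqEdge x t)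
    (hyt : ∀ s, c ≤ s → s < d → seqEdge y s ≠ seqEdge x t)
    (hmax : ∀ e ∈ pairEdges x y a b c d, π e ≤ π (seqEdge x t)) :
    ((b - a) + (d - c) ≤ 2 * k →
      ∃ e ∈ pairEdges x y a b c d, s(seqEdge x t, e) ∈ B) ∧
    ((b - a) + (d - c) ≤ k + 1 →
      ∃ e ∈ pairEdges x y a b c d, ∃ e' ∈ pairEdges x y a b c d, e ≠ e' ∧
        s(seqEdge x t, e) ∈ B ∧ s(seqEdge x t, e') ∈ B) := by
  obtain ⟨w, p, hp, hm, hsub, hlen⟩ := exists_isCycle_of_seqs hx hy hcd hat htb h0 h1 hxt hyt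
  have hlast : IsLastEdge π p.edges (seqEdge x t) := ⟨hm, fun e he => hmax e (hsub e he)⟩
  constructor
  · intro hk
    obtain ⟨b1, hb1, hc1⟩ := hB.2.1 w p hp (hlen.trans hk)
    obtain ⟨e, he, rfl⟩ := hc1.exists_of_last hπ hlast
    exact ⟨e, hsub e he, hb1⟩
  · intro hk
    obtain ⟨b1, hb1, b2, hb2, hne, hc1, hc2⟩ := hB.2.2 w p hp (hlen.trans hk)
    obtain ⟨e, he, rfl⟩ := hc1.exists_of_last hπ hlast
    obtain ⟨e', he', rfl⟩ := hc2.exists_of_last hπ hlast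
    exact ⟨e, hsub e he, e', hsub e' he', fun h => hne (by rw [h]), hb1, hb2⟩

/-! ### Counting by successively fixing observables -/

/-- The observable `r` is constant on `S`. -/
def Fixed {α V : Type} (S : Set α) (r : α → V) : Prop := ∀ h ∈ S, ∀ h' ∈ S, r h = r h'

theorem Fixed.mono {α V : Type} {S T : Set α} {r : α → V} (h : Fixed S r) (hT : T ⊆ S) :
    Fixed T r := fun a ha b hb => h a (hT ha) b (hT hb)

theorem Fixed.congr {α V : Type} {S : Set α} {r r' : α → V} (h : Fixed S r)
    (hr : ∀ a ∈ S, r a = r' a) : Fixed S r' := fun a ha b hb => by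
  rw [← hr a ha, ← hr b hb, h a ha b hb]

theorem ncard_le_of_cover {α ι : Type} [Finite α] {S : Set α} (I : Finset ι) (R : ι → α → Prop)
    (C : ℕ) (hcov : ∀ h ∈ S, ∃ i ∈ I, R i h)
    (hC : ∀ i ∈ I, ∀ T ⊆ S, (∀ h ∈ T, R i h) → T.ncard ≤ C) : S.ncard ≤ I.card * C := by
  classical
  have hsub : S ⊆ ⋃ i ∈ I, {h ∈ S | R i h} := by
    intro h hh
    obtain ⟨i, hi, hr⟩ := hcov h hh
    simp only [Set.mem_iUnion]
    exact ⟨i, hi, hh, hr⟩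
  calc S.ncard ≤ (⋃ i ∈ I, {h ∈ S | R i h}).ncard := Set.ncard_le_ncard hsub (Set.toFinite _)
    _ ≤ ∑ i ∈ I, {h ∈ S | R i h}.ncard := Finset.set_ncard_biUnion_le _ _
    _ ≤ ∑ _i ∈ I, C := Finset.sum_le_sum fun i hi => hC i hi _ (fun h hh => hh.1) fun h hh => hh.2
    _ = I.card * C := by simp

theorem ncard_le_of_start {α V : Type} [Finite α] [Fintype V] {S : Set α} (r : α → V) {C : ℕ}
    (hC : ∀ T ⊆ S, Fixed T r → T.ncard ≤ C) : S.ncard ≤ Fintype.card V * C :=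
  ncard_le_of_cover Finset.univ (fun v h => r h = v) C (fun h _ => ⟨r h, Finset.mem_univ _, rfl⟩)
    fun _ _ T hT hv => hC T hT fun a ha b hb => (hv a ha).trans (hv b hb).symm

theorem ncard_le_of_adj {α V : Type} [Finite α] [Fintype V] {H : SimpleGraph V} {Δ : ℕ}
    (hΔ : ∀ v, (H.neighborSet v).ncard ≤ Δ) {S : Set α} {r r' : α → V} (hr : Fixed S r)
    (hadj : ∀ h ∈ S, H.Adj (r h) (r' h)) {C : ℕ}
    (hC : ∀ T ⊆ S, Fixed T r' → T.ncard ≤ C) : S.ncard ≤ Δ * C := by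
  classical
  rcases S.eq_empty_or_nonempty with rfl | ⟨a, ha⟩
  · simp
  refine (ncard_le_of_cover (H.neighborSet (r a)).toFinite.toFinset (fun v h => r' h = v) C
    (fun h hh => ⟨r' h, ?_, rfl⟩)
    fun v _ T hT hv => hC T hT fun a ha b hb => (hv a ha).trans (hv b hb).symm).trans ?_
  · rw [Set.Finite.mem_toFinset, mem_neighborSet, hr a ha h hh]
    exact hadj h hh
  · rw [← Set.ncard_eq_toFinset_card]
    exact Nat.mul_le_mul_right _ (hΔ _)

theorem ncard_le_of_walk {α V : Type} [Finite α] [Fintype V] {H : SimpleGraph V} {Δ : ℕ}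
    (hΔ : ∀ v, (H.neighborSet v).ncard ≤ Δ) (Y : ℕ → α → V) (i n : ℕ) {C : ℕ} {S : Set α}
    (hadj : ∀ h ∈ S, ∀ t, i ≤ t → t < i + n → H.Adj (Y t h) (Y (t + 1) h))
    (hY : Fixed S (Y i))
    (hC : ∀ T ⊆ S, (∀ t, i ≤ t → t ≤ i + n → Fixed T (Y t)) → T.ncard ≤ C) :
    S.ncard ≤ Δ ^ n * C := by
  induction n generalizing C S with
  | zero =>
    rw [pow_zero, one_mul]
    refine hC S subset_rfl fun t h1 h2 => ?_
    obtain rfl : t = i := by omega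
    exact hY
  | succ n ih =>
    rw [pow_succ, mul_assoc]
    refine ih (fun h hh t h1 h2 => hadj h hh t h1 (by omega)) hY fun T hT hfix => ?_
    refine ncard_le_of_adj hΔ (hfix (i + n) (by omega) le_rfl)
      (fun h hh => hadj h (hT hh) (i + n) (by omega) (by omega)) fun U hU hfix' => ?_
    refine hC U (hU.trans hT) fun t h1 h2 => ?_
    rcases (show t ≤ i + n ∨ t = i + n + 1 by omega) with h3 | rfl
    · exact (hfix t h1 h3).mono hU
    · exact hfix'

/-- The edges that form a pair of `B` together with `e`. -/
def partners {V : Type} (B : Finset (Sym2 (Sym2 V))) (e : Sym2 V) : Set (Sym2 V) :=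
  {e' | s(e, e') ∈ B}

theorem ncard_partners_le {V : Type} [Fintype V] {H : SimpleGraph V} {π : Sym2 V → ℕ} {k f : ℕ}
    {B : Finset (Sym2 (Sym2 V))} (hB : IsDoubleBlockingSet H π k B)
    (hf : ∀ e ∈ H.edgeSet, edgeBlockCount B e ≤ f) (e : Sym2 V) : (partners B e).ncard ≤ f := by
  rcases (partners B e).eq_empty_or_nonempty with h | ⟨e', he'⟩
  · simp [h]
  refine le_trans ?_ (hf e ((hB.1 _ he').2 e (Sym2.mem_mk_left _ _)))
  refine Set.ncard_le_ncard_of_injOn (fun x => s(e, x)) (fun x hx => ⟨hx, Sym2.mem_mk_left _ _⟩)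
    (fun x _ y _ hxy => Sym2.congr_right.1 hxy) (Set.toFinite _)

theorem ncard_le_of_partner {α V : Type} [Finite α] [Fintype V] {B : Finset (Sym2 (Sym2 V))}
    {f : ℕ} (hf : ∀ e, (partners B e).ncard ≤ f) {S : Set α} {r r' s s' : α → V}
    (hr : Fixed S r) (hr' : Fixed S r')
    (hS : ∀ h ∈ S, s(s(r h, r' h), s(s h, s' h)) ∈ B) {C : ℕ}
    (hC : ∀ T ⊆ S, Fixed T s → Fixed T s' → T.ncard ≤ C) : S.ncard ≤ 2 * f * C := by
  classical
  rcases S.eq_empty_or_nonempty with rfl | ⟨a, ha⟩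
  · simp
  have key : S.ncard ≤ (partners B s(r a, r' a)).toFinite.toFinset.card * (2 * C) := by
    refine ncard_le_of_cover _ (fun e h => s(s h, s' h) = e) _
      (fun h hh => ⟨s(s h, s' h), ?_, rfl⟩) fun e _ T hT he => ?_
    · rw [Set.Finite.mem_toFinset, partners, Set.mem_ofPred_eq, hr a ha h hh, hr' a ha h hh]
      exact hS h hh
    · induction e with | _ u v
      refine (ncard_le_of_cover (Finset.univ : Finset Bool)
        (fun b h => (s h, s' h) = bif b then (u, v) else (v, u)) C (fun h hh => ?_)
        fun b _ U hU hb => hC U (hU.trans hT) ?_ ?_).trans (by simp)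
      · rcases Sym2.eq_iff.1 (he h hh) with ⟨h1, h2⟩ | ⟨h1, h2⟩
        · exact ⟨true, Finset.mem_univ _, by simp [h1, h2]⟩
        · exact ⟨false, Finset.mem_univ _, by simp [h1, h2]⟩
      · exact fun x hx y hy => congrArg Prod.fst ((hb x hx).trans (hb y hy).symm)
      · exact fun x hx y hy => congrArg Prod.snd ((hb x hx).trans (hb y hy).symm)
  rw [← Set.ncard_eq_toFinset_card] at key
  calc S.ncard ≤ _ := key
    _ ≤ f * (2 * C) := Nat.mul_le_mul_right _ (hf _)
    _ = 2 * f * C := by ring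

/-- In the sequence `x` on `[a, b]`, the edge `t` is blocked by no edge of the sequence, or by
at most one while the sequence is short enough for double blocking. -/
def WeaklyUnblocked {V : Type} (B : Finset (Sym2 (Sym2 V))) (k : ℕ) (x : ℕ → V) (a b t : ℕ) :
    Prop :=
  (b - a ≤ k ∧ ∀ s, a ≤ s → s < b → s(seqEdge x t, seqEdge x s) ∉ B) ∨
  (2 * (b - a) ≤ k + 1 ∧ ∃ e, ∀ s, a ≤ s → s < b →
    s(seqEdge x t, seqEdge x s) ∈ B → seqEdge x s = e)

theorem exists_edge_eq_or_partner {V : Type} [DecidableEq V] {H : SimpleGraph V}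
    {π : Sym2 V → ℕ} {k : ℕ} {B : Finset (Sym2 (Sym2 V))} (hB : IsDoubleBlockingSet H π k B)
    (hπ : Set.InjOn π H.edgeSet) {x y : ℕ → V} {a b t : ℕ}
    (hx : ∀ s, a ≤ s → s < b → H.Adj (x s) (x (s + 1)))
    (hy : ∀ s, a ≤ s → s < b → H.Adj (y s) (y (s + 1)))
    (hat : a ≤ t) (htb : t < b) (h0 : x a = y a) (h1 : x b = y b)
    (hxt : ∀ s, a ≤ s → s < b → s ≠ t → seqEdge x s ≠ seqEdge x t)
    (hmax : ∀ e ∈ pairEdges x y a b a b, π e ≤ π (seqEdge x t))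
    (hun : WeaklyUnblocked B k x a b t) :
    ∃ s, a ≤ s ∧ s < b ∧ (seqEdge y s = seqEdge x t ∨ s(seqEdge x t, seqEdge y s) ∈ B) := by
  by_cases hyt : ∀ s, a ≤ s → s < b → seqEdge y s ≠ seqEdge x t
  · have key := hB.exists_block hπ hx hy (by omega) hat htb h0 h1 hxt hyt hmax
    rcases hun with ⟨hk, hun⟩ | ⟨hk, e0, hun⟩
    · obtain ⟨e, he, heB⟩ := key.1 (by omega)
      rcases mem_pairEdges.1 he with ⟨s, hs1, hs2, rfl⟩ | ⟨s, hs1, hs2, rfl⟩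
      · exact absurd heB (hun s hs1 hs2)
      · exact ⟨s, hs1, hs2, Or.inr heB⟩
    · obtain ⟨e, he, e', he', hne, heB, heB'⟩ := key.2 (by omega)
      rcases mem_pairEdges.1 he with ⟨s, hs1, hs2, rfl⟩ | ⟨s, hs1, hs2, rfl⟩
      · rcases mem_pairEdges.1 he' with ⟨s', hs1', hs2', rfl⟩ | ⟨s', hs1', hs2', rfl⟩
        · exact absurd ((hun s hs1 hs2 heB).trans (hun s' hs1' hs2' heB').symm) hne
        · exact ⟨s', hs1', hs2', Or.inr heB'⟩
      · exact ⟨s, hs1, hs2, Or.inr heB⟩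
  · push Not at hyt
    obtain ⟨s, hs1, hs2, hs3⟩ := hyt
    exact ⟨s, hs1, hs2, Or.inl hs3⟩

/-- The end vertices of `e` and of its partners. -/
def partnerVerts {V : Type} (B : Finset (Sym2 (Sym2 V))) (e : Sym2 V) : Set V :=
  {x | ∃ e', (e' = e ∨ s(e, e') ∈ B) ∧ x ∈ e'}

theorem ncard_partnerVerts_le {V : Type} [Fintype V] {B : Finset (Sym2 (Sym2 V))} {f : ℕ}
    (hf : ∀ e, (partners B e).ncard ≤ f) (hf1 : 1 ≤ f) (e : Sym2 V) :
    (partnerVerts B e).ncard ≤ 4 * f := by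
  classical
  set I : Finset (Sym2 V) := insert e (partners B e).toFinite.toFinset with hI
  have hsub : partnerVerts B e ⊆ ((I.biUnion Sym2.toFinset : Finset V) : Set V) := by
    rintro x ⟨e', he', hx⟩
    simp only [Finset.coe_biUnion, Set.mem_iUnion, Finset.mem_coe, Sym2.mem_toFinset]
    refine ⟨e', ?_, hx⟩
    rw [hI, Finset.mem_insert, Set.Finite.mem_toFinset]
    exact he'
  have hIc : I.card ≤ f + 1 := by
    refine (Finset.card_insert_le _ _).trans ?_
    rw [← Set.ncard_eq_toFinset_card]
    exact Nat.add_le_add_right (hf e) 1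
  calc (partnerVerts B e).ncard ≤ _ := Set.ncard_le_ncard hsub (Set.toFinite _)
    _ = (I.biUnion Sym2.toFinset).card := Set.ncard_coe_finset _
    _ ≤ ∑ e' ∈ I, (Sym2.toFinset e').card := Finset.card_biUnion_le
    _ ≤ ∑ _e' ∈ I, 2 := Finset.sum_le_sum fun e' _ => by
        rw [Sym2.card_toFinset]; split_ifs <;> omega
    _ = I.card * 2 := by simp
    _ ≤ 4 * f := by omega

theorem ncard_le_of_fill {α V : Type} [Finite α] [Fintype V] {H : SimpleGraph V}
    {π : Sym2 V → ℕ} {k : ℕ} {B : Finset (Sym2 (Sym2 V))} (hB : IsDoubleBlockingSet H π k B)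
    (hπ : Set.InjOn π H.edgeSet) {f : ℕ} (hf : ∀ e, (partners B e).ncard ≤ f) (hf1 : 1 ≤ f)
    (Y : ℕ → α → V) (lo hi : ℕ) (hlen : hi - lo ≤ k + 1) {S₀ : Set α}
    (hadj : ∀ h ∈ S₀, ∀ t, lo ≤ t → t < hi → H.Adj (Y t h) (Y (t + 1) h))
    (hinj : ∀ h ∈ S₀, ∀ s t, lo ≤ s → s < hi → lo ≤ t → t < hi → s ≠ t →
      seqEdge (Y · h) s ≠ seqEdge (Y · h) t)
    (hun : ∀ h ∈ S₀, ∀ a b t, lo ≤ a → a ≤ t → t < b → b ≤ hi →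
      (∀ s, a ≤ s → s < b → π (seqEdge (Y · h) s) ≤ π (seqEdge (Y · h) t)) →
      WeaklyUnblocked B k (Y · h) a b t) (n : ℕ) :
    ∀ (a b C : ℕ) (S : Set α), b - a = n → lo ≤ a → b ≤ hi → S ⊆ S₀ → Fixed S (Y a) →
      Fixed S (Y b) →
      (∀ T ⊆ S, (∀ t, a ≤ t → t ≤ b → Fixed T (Y t)) → T.ncard ≤ C) →
      S.ncard ≤ (4 * (k + 1) * f) ^ (b - a - 1) * C := by
  classical
  induction n using Nat.strong_induction_on with
  | _ n ih =>
  intro a b C S hn ha hb hS hfa hfb hC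
  have hF : 1 ≤ 4 * (k + 1) * f := Nat.mul_pos (by omega) hf1
  by_cases hsmall : b - a ≤ 1
  · refine (hC S subset_rfl fun t h1 h2 => ?_).trans
      (Nat.le_mul_of_pos_left _ (Nat.pow_pos hF))
    rcases (show t = a ∨ t = b by omega) with rfl | rfl
    · exact hfa
    · exact hfb
  rcases S.eq_empty_or_nonempty with rfl | ⟨h₁, hh₁⟩
  · simp
  obtain ⟨⟨h₀, t₀⟩, hmem, hmax⟩ := Set.exists_max_image (S ×ˢ Set.Ico a b)
    (fun z => π (seqEdge (Y · z.1) z.2)) (Set.toFinite _) ⟨(h₁, a), hh₁, by simp; omega⟩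
  obtain ⟨hh₀, ht1, ht2⟩ := hmem
  have hmax' : ∀ h ∈ S, ∀ s, a ≤ s → s < b →
      π (seqEdge (Y · h) s) ≤ π (seqEdge (Y · h₀) t₀) := fun h hh s hs1 hs2 =>
    hmax (h, s) ⟨hh, hs1, hs2⟩
  simp only at hh₀ ht1 ht2
  have hstep : S.ncard ≤ (Finset.Ioo a b ×ˢ
      (partnerVerts B (seqEdge (Y · h₀) t₀)).toFinite.toFinset).card *
        ((4 * (k + 1) * f) ^ (b - a - 2) * C) := by
    refine ncard_le_of_cover _ (fun z h => Y z.1 h = z.2) _ (fun h hh => ?_) ?_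
    · obtain ⟨s, hs1, hs2, hs⟩ := exists_edge_eq_or_partner (x := (Y · h₀)) (y := (Y · h)) hB hπ
        (fun s h1 h2 => hadj h₀ (hS hh₀) s (by omega) (by omega))
        (fun s h1 h2 => hadj h (hS hh) s (by omega) (by omega)) ht1 ht2
        (hfa _ hh₀ _ hh) (hfb _ hh₀ _ hh)
        (fun s h1 h2 h3 => hinj h₀ (hS hh₀) s t₀ (by omega) (by omega) (by omega) (by omega) h3)
        (fun e he => by
          rcases mem_pairEdges.1 he with ⟨s, h1, h2, rfl⟩ | ⟨s, h1, h2, rfl⟩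
          · exact hmax' _ hh₀ s h1 h2
          · exact hmax' _ hh s h1 h2)
        (hun h₀ (hS hh₀) a b t₀ ha ht1 ht2 hb (hmax' _ hh₀))
      have hW : ∀ v ∈ seqEdge (Y · h) s, v ∈ partnerVerts B (seqEdge (Y · h₀) t₀) :=
        fun v hv => ⟨_, hs, hv⟩
      by_cases hsa : a < s
      · refine ⟨(s, Y s h), ?_, rfl⟩
        simp only [Finset.mem_product, Finset.mem_Ioo, Set.Finite.mem_toFinset]
        exact ⟨⟨hsa, hs2⟩, hW _ (Sym2.mem_mk_left _ _)⟩
      · refine ⟨(s + 1, Y (s + 1) h), ?_, rfl⟩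
        simp only [Finset.mem_product, Finset.mem_Ioo, Set.Finite.mem_toFinset]
        exact ⟨⟨by omega, by omega⟩, hW _ (Sym2.mem_mk_right _ _)⟩
    · rintro ⟨t, v⟩ htv T hT hv
      simp only [Finset.mem_product, Finset.mem_Ioo] at htv
      obtain ⟨⟨hat, htb⟩, -⟩ := htv
      have hft : Fixed T (Y t) := fun x hx y hy => (hv x hx).trans (hv y hy).symm
      have e1 : b - a - 2 = (t - a - 1) + (b - t - 1) := by omega
      rw [e1, pow_add, mul_assoc]
      refine ih (t - a) (by omega) a t _ T rfl ha (by omega) (hT.trans hS) (hfa.mono hT) hft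
        fun U hU hfU => ?_
      refine ih (b - t) (by omega) t b _ U rfl (by omega) hb (hU.trans (hT.trans hS))
        (hft.mono hU) (hfb.mono (hU.trans hT)) fun W hW hfW => ?_
      refine hC W (hW.trans (hU.trans hT)) fun s h1 h2 => ?_
      rcases le_total s t with h3 | h3
      · exact (hfU s h1 h3).mono hW
      · exact hfW s h3 h2
  refine hstep.trans ?_
  rw [← mul_assoc]
  refine Nat.mul_le_mul_right _ ?_
  rw [show b - a - 1 = (b - a - 2) + 1 by omega, pow_succ']
  refine Nat.mul_le_mul_right _ ?_
  rw [Finset.card_product, Nat.card_Ioo, ← Set.ncard_eq_toFinset_card]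
  calc (b - a - 1) * _ ≤ (k + 1) * (4 * f) :=
        Nat.mul_le_mul (by omega) (ncard_partnerVerts_le hf hf1 _)
    _ = 4 * (k + 1) * f := by ring


/-! ### SCUM paths as sequences indexed by `ℕ` -/

/-- The SCUM condition for the first `2g + 2` vertices of a sequence. -/
structure IsScumSeq {V : Type} (H : SimpleGraph V) (π : Sym2 V → ℕ) (B : Finset (Sym2 (Sym2 V)))
    (g : ℕ) (p : ℕ → V) : Prop where
  inj : ∀ i j, i ≤ 2 * g + 1 → j ≤ 2 * g + 1 → p i = p j → i = j
  adj : ∀ i, i < 2 * g + 1 → H.Adj (p i) (p (i + 1))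
  mid : ∀ i, i < 2 * g + 1 → π (seqEdge p i) ≤ π (seqEdge p g)
  left : ∀ i j, i ≤ g → j < i → ∀ e', s(seqEdge p i, e') ∈ B → p j ∉ e'
  right : ∀ i j, g ≤ i → i + 2 ≤ j → j ≤ 2 * g + 1 → ∀ e', s(seqEdge p i, e') ∈ B → p j ∉ e'

/-- The sequence of `2g + 2` vertices read backwards. -/
def revSeq {V : Type} (g : ℕ) (p : ℕ → V) (i : ℕ) : V := p (2 * g + 1 - i)

theorem seqEdge_revSeq {V : Type} {g : ℕ} (p : ℕ → V) {i : ℕ} (hi : i < 2 * g + 1) :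
    seqEdge (revSeq g p) i = seqEdge p (2 * g - i) := by
  rw [seqEdge, revSeq, revSeq, seqEdge, Sym2.eq_swap,
    show 2 * g + 1 - (i + 1) = 2 * g - i by omega, show 2 * g + 1 - i = 2 * g - i + 1 by omega]

section ScumSeq

variable {V : Type} {H : SimpleGraph V} {π : Sym2 V → ℕ} {B : Finset (Sym2 (Sym2 V))} {g : ℕ}
  {p : ℕ → V}

theorem IsScumSeq.rev (hp : IsScumSeq H π B g p) : IsScumSeq H π B g (revSeq g p) where
  inj i j hi hj h := by
    have := hp.inj _ _ (by omega) (by omega) h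
    omega
  adj i hi := by
    have := hp.adj (2 * g - i) (by omega)
    rw [revSeq, revSeq, show 2 * g + 1 - (i + 1) = 2 * g - i by omega,
      show 2 * g + 1 - i = 2 * g - i + 1 by omega]
    exact this.symm
  mid i hi := by
    rw [seqEdge_revSeq p hi, seqEdge_revSeq p (by omega), show 2 * g - g = g by omega]
    exact hp.mid _ (by omega)
  left i j hi hj e' he' := by
    rw [seqEdge_revSeq p (by omega)] at he'
    exact hp.right _ _ (by omega) (by omega) (by omega) e' he'
  right i j hi hij hj e' he' := by
    rw [seqEdge_revSeq p (by omega)] at he'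
    exact hp.left _ _ (by omega) (by omega) e' he'

theorem IsScumSeq.seqEdge_ne (hp : IsScumSeq H π B g p) {i j : ℕ} (hi : i < 2 * g + 1)
    (hj : j < 2 * g + 1) (hij : i ≠ j) : seqEdge p i ≠ seqEdge p j := by
  intro h
  rcases Sym2.eq_iff.1 h with ⟨h1, -⟩ | ⟨h1, h2⟩
  · exact hij (hp.inj _ _ (by omega) (by omega) h1)
  · have := hp.inj _ _ (by omega) (by omega) h1
    have := hp.inj _ _ (by omega) (by omega) h2
    omega

theorem IsScumSeq.mem_edgeSet (hp : IsScumSeq H π B g p) {i : ℕ} (hi : i < 2 * g + 1) :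
    seqEdge p i ∈ H.edgeSet := hp.adj i hi

theorem IsScumSeq.left_notMem (hp : IsScumSeq H π B g p) {s t : ℕ} (hst : s < t) (ht : t ≤ g) :
    s(seqEdge p t, seqEdge p s) ∉ B := fun h =>
  hp.left t s ht hst _ h (Sym2.mem_mk_left _ _)

theorem IsScumSeq.right_notMem (hp : IsScumSeq H π B g p) {s t : ℕ} (hst : t < s) (ht : g ≤ t)
    (hs : s < 2 * g + 1) : s(seqEdge p t, seqEdge p s) ∉ B := fun h =>
  hp.right t (s + 1) ht (by omega) (by omega) _ h (Sym2.mem_mk_right _ _)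

/-- In any segment of a SCUM path, the last edge is not paired with another edge of the segment. -/
theorem IsScumSeq.notMem_of_latest (hp : IsScumSeq H π B g p) {k : ℕ}
    (hB : IsDoubleBlockingSet H π k B) (hπ : Set.InjOn π H.edgeSet) {a b t : ℕ}
    (hb : b ≤ 2 * g + 1) (hat : a ≤ t) (htb : t < b)
    (hmax : ∀ s, a ≤ s → s < b → π (seqEdge p s) ≤ π (seqEdge p t)) {s : ℕ} (has : a ≤ s)
    (hsb : s < b) : s(seqEdge p t, seqEdge p s) ∉ B := by
  intro h
  have hst : s ≠ t := by
    rintro rfl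
    exact (hB.1 _ h).1 rfl
  have h' := h
  rw [Sym2.eq_swap] at h'
  have l1 : s < t → ¬ t ≤ g := fun h1 h2 => hp.left_notMem h1 h2 h
  have l2 : t < s → ¬ s ≤ g := fun h1 h2 => hp.left_notMem h1 h2 h'
  have r1 : t < s → ¬ g ≤ t := fun h1 h2 => hp.right_notMem h1 h2 (by omega) h
  have r2 : s < t → ¬ g ≤ s := fun h1 h2 => hp.right_notMem h1 h2 (by omega) h'
  refine hp.seqEdge_ne (show t < 2 * g + 1 by omega) (show g < 2 * g + 1 by omega) (by omega) ?_
  exact hπ (hp.mem_edgeSet (by omega)) (hp.mem_edgeSet (by omega))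
    (le_antisymm (hp.mid _ (by omega)) (hmax g (by omega) (by omega)))

end ScumSeq

/-! ### Counting pairs of SCUM paths -/

/-- The running assumptions of the counting argument. -/
structure CountingSetup {V : Type} (H : SimpleGraph V) (π : Sym2 V → ℕ)
    (B : Finset (Sym2 (Sym2 V))) (g Δ f : ℕ) : Prop where
  block : IsDoubleBlockingSet H π (2 * g + 1) B
  injOn : Set.InjOn π H.edgeSet
  degree : ∀ v, (H.neighborSet v).ncard ≤ Δ
  partner : ∀ e, (partners B e).ncard ≤ f
  one_le_degree : 1 ≤ Δ
  one_le_partner : 1 ≤ f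

/-- The set of known positions `K`, enlarged by the positions `[i, j]` of the sequence `b`. -/
def extendKnown (K : Bool → ℕ → Prop) (b : Bool) (i j : ℕ) (b' : Bool) (t : ℕ) : Prop :=
  K b' t ∨ (b' = b ∧ i ≤ t ∧ t ≤ j)

/-- There are at most `Δ ^ x * (4 (2g + 2) f) ^ y` elements of `S` with prescribed vertices at
the positions in `K`. -/
def BoundedBy {V α : Type} (g Δ f : ℕ) (W : Bool → ℕ → α → V) (S : Set α)
    (K : Bool → ℕ → Prop) (x y : ℕ) : Prop :=
  ∀ T ⊆ S, (∀ b t, K b t → Fixed T (W b t)) → T.ncard ≤ Δ ^ x * (4 * (2 * g + 1 + 1) * f) ^ y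

section Counting

variable {V α : Type} {g Δ f : ℕ} {W : Bool → ℕ → α → V} {S : Set α} {K : Bool → ℕ → Prop}
  {x y : ℕ}

theorem BoundedBy.apply {b : Bool} {i j : ℕ} {T : Set α}
    (h : BoundedBy g Δ f W S (extendKnown K b i j) x y) (hT : T ⊆ S)
    (hK : ∀ b t, K b t → Fixed T (W b t)) {U : Set α} (hU : U ⊆ T)
    (hnew : ∀ t, i ≤ t → t ≤ j → Fixed U (W b t)) :
    U.ncard ≤ Δ ^ x * (4 * (2 * g + 1 + 1) * f) ^ y := by
  refine h U (hU.trans hT) fun b' t ht => ?_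
  rcases ht with ht | ⟨rfl, h1, h2⟩
  · exact (hK b' t ht).mono hU
  · exact hnew t h1 h2

theorem BoundedBy.link (b : Bool) (i j : ℕ)
    (hl : ∀ t, i ≤ t → t ≤ j → ∃ b' s, K b' s ∧ ∀ h ∈ S, W b' s h = W b t h)
    (h : BoundedBy g Δ f W S (extendKnown K b i j) x y) : BoundedBy g Δ f W S K x y := by
  intro T hT hK
  refine h.apply hT hK subset_rfl fun t h1 h2 => ?_
  obtain ⟨b', s, hs, heq⟩ := hl t h1 h2
  exact (hK b' s hs).congr fun h hh => heq h (hT hh)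

theorem BoundedBy.link_one (b : Bool) (i : ℕ) (b' : Bool) (j : ℕ) (hK : K b i)
    (heq : ∀ h ∈ S, W b i h = W b' j h)
    (h : BoundedBy g Δ f W S (extendKnown K b' j j) x y) : BoundedBy g Δ f W S K x y :=
  .link b' j j (fun t h1 h2 => ⟨b, i, hK, by rwa [show t = j by omega]⟩) h

variable [Finite α] {H : SimpleGraph V} {π : Sym2 V → ℕ} {B : Finset (Sym2 (Sym2 V))}

theorem BoundedBy.finish (hc : CountingSetup H π B g Δ f)
    (hsep : ∀ h ∈ S, ∀ h' ∈ S, (∀ b t, t ≤ 2 * g + 1 → W b t h = W b t h') → h = h')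
    (hK : ∀ b t, t ≤ 2 * g + 1 → K b t) : BoundedBy g Δ f W S K x y := by
  intro T hT hfix
  refine le_trans ?_ (Nat.mul_pos (Nat.pow_pos hc.one_le_degree)
    (Nat.pow_pos (Nat.mul_pos (by omega) hc.one_le_partner)))
  rw [Nat.succ_eq_add_one, Nat.zero_add, Set.ncard_le_one (Set.toFinite _)]
  exact fun h hh h' hh' => hsep h (hT hh) h' (hT hh') fun b t ht => hfix b t (hK b t ht) h hh h' hh'

variable [Fintype V]

theorem BoundedBy.start (b : Bool) (i : ℕ)
    (h : BoundedBy g Δ f W S (extendKnown (fun _ _ => False) b i i) x y) :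
    S.ncard ≤ Fintype.card V * (Δ ^ x * (4 * (2 * g + 1 + 1) * f) ^ y) :=
  ncard_le_of_start (W b i) fun T hT hfix => h T hT fun b' t ht => by
    rcases ht with ht | ⟨rfl, h1, h2⟩
    · exact ht.elim
    · rwa [show t = i by omega]

theorem BoundedBy.up (hc : CountingSetup H π B g Δ f)
    (hW : ∀ h ∈ S, ∀ b, IsScumSeq H π B g (W b · h)) (b : Bool) (i j : ℕ) (hij : i ≤ j)
    (hj : j ≤ 2 * g + 1) (hK : K b i) (hx : j - i ≤ x)
    (h : BoundedBy g Δ f W S (extendKnown K b i j) (x - (j - i)) y) :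
    BoundedBy g Δ f W S K x y := by
  intro T hT hfix
  rw [show x = (j - i) + (x - (j - i)) by omega, pow_add, mul_assoc]
  refine ncard_le_of_walk hc.degree (W b) i (j - i)
    (fun h hh t _ h2 => (hW h (hT hh) b).adj t (by omega)) (hfix b i hK) fun U hU hnew => ?_
  exact h.apply hT hfix hU fun t h1 h2 => hnew t h1 (by omega)

theorem BoundedBy.down (hc : CountingSetup H π B g Δ f)
    (hW : ∀ h ∈ S, ∀ b, IsScumSeq H π B g (W b · h)) (b : Bool) (i j : ℕ) (hij : i ≤ j)
    (hj : j ≤ 2 * g + 1) (hK : K b j) (hx : j - i ≤ x)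
    (h : BoundedBy g Δ f W S (extendKnown K b i j) (x - (j - i)) y) :
    BoundedBy g Δ f W S K x y := by
  intro T hT hfix
  rw [show x = (j - i) + (x - (j - i)) by omega, pow_add, mul_assoc]
  refine ncard_le_of_walk hc.degree (fun t h => revSeq g (W b · h) t) (2 * g + 1 - j) (j - i)
    (fun h hh t _ h2 => (hW h (hT hh) b).rev.adj t (by omega)) ?_ fun U hU hnew => ?_
  · refine (hfix b j hK).congr fun h _ => ?_
    simp only [revSeq]
    congr 1
    omega
  · refine h.apply hT hfix hU fun t h1 h2 => ?_
    refine (hnew (2 * g + 1 - t) (by omega) (by omega)).congr fun h _ => ?_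
    simp only [revSeq]
    congr 1
    omega

theorem BoundedBy.pair (hc : CountingSetup H π B g Δ f) (b b' : Bool) (i j : ℕ)
    (hK : K b i) (hK' : K b (i + 1)) (hy : 1 ≤ y)
    (hpair : ∀ h ∈ S, s(seqEdge (W b · h) i, seqEdge (W b' · h) j) ∈ B)
    (h : BoundedBy g Δ f W S (extendKnown K b' j (j + 1)) x (y - 1)) :
    BoundedBy g Δ f W S K x y := by
  intro T hT hfix
  have key := ncard_le_of_partner hc.partner (hfix b i hK) (hfix b (i + 1) hK')
    (fun h hh => hpair h (hT hh)) fun U hU h1 h2 => h.apply hT hfix hU fun t h3 h4 => by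
      rcases (show t = j ∨ t = j + 1 by omega) with rfl | rfl
      exacts [h1, h2]
  refine key.trans ?_
  rw [show y = 1 + (y - 1) by omega, pow_add, pow_one, ← mul_assoc, ← mul_assoc,
    Nat.add_sub_cancel_left, mul_right_comm, mul_comm (Δ ^ x), mul_right_comm]
  refine Nat.mul_le_mul_right _ (Nat.mul_le_mul_right _ ?_)
  exact Nat.mul_le_mul_right _ (by omega)

theorem BoundedBy.gap (hc : CountingSetup H π B g Δ f)
    (hW : ∀ h ∈ S, ∀ b, IsScumSeq H π B g (W b · h)) (b : Bool) (i j : ℕ)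
    (hj : j ≤ 2 * g + 1) (hK : K b i) (hK' : K b j) (hy : j - i - 1 ≤ y)
    (h : BoundedBy g Δ f W S (extendKnown K b i j) x (y - (j - i - 1))) :
    BoundedBy g Δ f W S K x y := by
  intro T hT hfix
  rw [show y = (j - i - 1) + (y - (j - i - 1)) by omega, pow_add, ← mul_assoc,
    mul_comm (Δ ^ x), mul_assoc]
  refine ncard_le_of_fill hc.block hc.injOn hc.partner hc.one_le_partner (W b) 0 (2 * g + 1)
    (by omega) (S₀ := S) (fun h hh t _ h2 => (hW h hh b).adj t h2)
    (fun h hh s t _ h2 _ h4 h5 => (hW h hh b).seqEdge_ne h2 h4 h5)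
    (fun h hh a c t _ h2 h3 h4 h5 => Or.inl ⟨by omega, fun s h6 h7 =>
      (hW h hh b).notMem_of_latest hc.block hc.injOn h4 h2 h3 h5 h6 h7⟩)
    _ i j _ T rfl (by omega) hj hT (hfix b i hK) (hfix b j hK') fun U hU hnew => ?_
  exact h.apply hT hfix hU hnew

/-- Filling a segment `[a, i]` of the first half of a SCUM path, given its end `i` and a vertex
`X` off the segment which is adjacent to its start. -/
theorem ncard_le_of_mixed (hc : CountingSetup H π B g Δ f) {X : α → V} {Y : ℕ → α → V}
    (hY : ∀ h ∈ S, IsScumSeq H π B g (Y · h)) {a i : ℕ} (hai : a ≤ i) (hi : i ≤ g)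
    (hX : ∀ h ∈ S, H.Adj (X h) (Y a h)) (hXY : ∀ h ∈ S, ∀ t, a ≤ t → t ≤ i → X h ≠ Y t h)
    (hfX : Fixed S X) (hfY : Fixed S (Y i)) {C : ℕ}
    (hC : ∀ T ⊆ S, (∀ t, a ≤ t → t ≤ i → Fixed T (Y t)) → T.ncard ≤ C) :
    S.ncard ≤ (4 * (2 * g + 1 + 1) * f) ^ (i - a) * C := by
  let Z : ℕ → α → V := fun n => n.casesOn X fun n => Y (a + n)
  have hE : ∀ h n, seqEdge (Z · h) (n + 1) = seqEdge (Y · h) (a + n) := fun h n => rfl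
  have hE0 : ∀ h, seqEdge (Z · h) 0 = s(X h, Y a h) := fun h => rfl
  have hne : ∀ h ∈ S, ∀ n, n < i - a → seqEdge (Z · h) 0 ≠ seqEdge (Z · h) (n + 1) := by
    intro h hh n hn heq
    rw [hE, hE0] at heq
    have hm : X h ∈ seqEdge (Y · h) (a + n) := heq ▸ Sym2.mem_mk_left _ _
    rcases Sym2.mem_iff.1 hm with h1 | h1
    · exact hXY h hh (a + n) (by omega) (by omega) h1
    · exact hXY h hh (a + n + 1) (by omega) (by omega) h1
  have hB0 : ∀ h ∈ S, ∀ n, 0 < n → n < i - a →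
      s(seqEdge (Y · h) (a + n), seqEdge (Z · h) 0) ∉ B := by
    intro h hh n hn hn' hmem
    refine (hY h hh).left (a + n) a (by omega) (by omega) _ hmem ?_
    exact Sym2.mem_mk_right _ _
  have hBY : ∀ h ∈ S, ∀ n m, n < i - a → m < i - a →
      s(seqEdge (Y · h) (a + n), seqEdge (Y · h) (a + m)) ∉ B := by
    intro h hh n m hn hm hmem
    rcases lt_trichotomy n m with h1 | rfl | h1
    · exact (hY h hh).left_notMem (show a + n < a + m by omega) (by omega) (Sym2.eq_swap ▸ hmem)
    · exact (hc.block.1 _ hmem).1 rfl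
    · exact (hY h hh).left_notMem (show a + m < a + n by omega) (by omega) hmem
  have := ncard_le_of_fill hc.block hc.injOn hc.partner hc.one_le_partner Z 0 (i - a + 1)
    (by omega) (S₀ := S) (C := C) ?_ ?_ ?_ _ 0 (i - a + 1) S rfl le_rfl le_rfl subset_rfl hfX ?_ ?_
  · simpa using this
  · rintro h hh (_ | t) - ht
    · exact hX h hh
    · exact (hY h hh).adj (a + t) (by omega)
  · rintro h hh (_ | s) (_ | t) - hs - ht hst
    · exact absurd rfl hst
    · exact hne h hh t (by omega)
    · exact (hne h hh s (by omega)).symm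
    · exact (hY h hh).seqEdge_ne (by omega) (by omega) (by omega)
  · rintro h hh a' b' (_ | t) - hat htb hb' -
    · refine Or.inr ⟨by omega, seqEdge (Z · h) 1, ?_⟩
      rintro (_ | _ | s) - hs hmem
      · exact absurd rfl (hc.block.1 _ hmem).1
      · rfl
      · exact absurd (Sym2.eq_swap ▸ hmem) (hB0 h hh (s + 1) (by omega) (by omega))
    · refine Or.inr ⟨by omega, seqEdge (Z · h) 0, ?_⟩
      rintro (_ | s) - hs hmem
      · rfl
      · exact absurd hmem (hBY h hh t s (by omega) (by omega))
  · change Fixed S (Y (a + (i - a)))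
    rwa [show a + (i - a) = i by omega]
  · intro T hT hfix
    refine hC T hT fun t h1 h2 => ?_
    have h3 : Fixed T (Y (a + (t - a))) := hfix (t - a + 1) (by omega) (by omega)
    rwa [show a + (t - a) = t by omega] at h3

theorem BoundedBy.mixed (hc : CountingSetup H π B g Δ f)
    (hW : ∀ h ∈ S, ∀ b, IsScumSeq H π B g (W b · h)) (b b' : Bool) (a i : ℕ) (hai : a ≤ i)
    (hi : i ≤ g) (hK : K b (a + 1)) (hK' : K b' i) (hy : i - a ≤ y)
    (heq : ∀ h ∈ S, W b a h = W b' a h)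
    (hne : ∀ h ∈ S, ∀ t, a ≤ t → t ≤ i → W b (a + 1) h ≠ W b' t h)
    (h : BoundedBy g Δ f W S (extendKnown K b' a i) x (y - (i - a))) :
    BoundedBy g Δ f W S K x y := by
  intro T hT hfix
  rw [show y = (i - a) + (y - (i - a)) by omega, pow_add, ← mul_assoc,
    mul_comm (Δ ^ x), mul_assoc]
  refine ncard_le_of_mixed hc (fun h hh => hW h (hT hh) b') hai hi
    (X := W b (a + 1)) (fun h hh => ?_) (fun h hh => hne h (hT hh)) (hfix _ _ hK) (hfix _ _ hK')
    fun U hU hnew => ?_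
  · rw [← heq h (hT hh)]
    exact ((hW h (hT hh) b).adj a (by omega)).symm
  · exact h.apply hT hfix hU hnew

theorem BoundedBy.mixed_rev (hc : CountingSetup H π B g Δ f)
    (hW : ∀ h ∈ S, ∀ b, IsScumSeq H π B g (W b · h)) (b b' : Bool) (i a : ℕ) (hai : i ≤ a)
    (hi : g + 1 ≤ i) (ha : a ≤ 2 * g + 1) (hK : K b (a - 1)) (hK' : K b' i) (hy : a - i ≤ y)
    (heq : ∀ h ∈ S, W b a h = W b' a h)
    (hne : ∀ h ∈ S, ∀ t, i ≤ t → t ≤ a → W b (a - 1) h ≠ W b' t h)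
    (h : BoundedBy g Δ f W S (extendKnown K b' i a) x (y - (a - i))) :
    BoundedBy g Δ f W S K x y := by
  intro T hT hfix
  rw [show y = (a - i) + (y - (a - i)) by omega, pow_add, ← mul_assoc,
    mul_comm (Δ ^ x), mul_assoc]
  have hrev : ∀ t, t ≤ 2 * g + 1 → ∀ h,
      revSeq g (W b' · h) (2 * g + 1 - t) = W b' t h := fun t ht h => by
    simp only [revSeq]
    congr 1
    omega
  have := ncard_le_of_mixed (S := T) (C := Δ ^ x * (4 * (2 * g + 1 + 1) * f) ^ (y - (a - i))) hc
    (X := W b (a - 1)) (Y := fun t h => revSeq g (W b' · h) t)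
    (a := 2 * g + 1 - a) (i := 2 * g + 1 - i) (fun h hh => (hW h (hT hh) b').rev) (by omega)
    (by omega) (fun h hh => ?_) (fun h hh t h1 h2 => ?_) (hfix _ _ hK) ?_ fun U hU hnew => ?_
  · rwa [show 2 * g + 1 - i - (2 * g + 1 - a) = a - i by omega] at this
  · rw [hrev a ha, ← heq h (hT hh)]
    have := (hW h (hT hh) b).adj (a - 1) (by omega)
    rwa [show a - 1 + 1 = a by omega] at this
  · exact hne h (hT hh) (2 * g + 1 - t) (by omega) (by omega)
  · exact (hfix b' i hK').congr fun h _ => (hrev i (by omega) h).symm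
  · refine h.apply hT hfix hU fun t h1 h2 => ?_
    exact (hnew (2 * g + 1 - t) (by omega) (by omega)).congr fun h _ => hrev t (by omega) h

/-! ### Families of meets -/

/-- The elements of `S` encode pairs of SCUM paths with common ends. -/
structure EncodesMeets {V α : Type} (H : SimpleGraph V) (π : Sym2 V → ℕ)
    (B : Finset (Sym2 (Sym2 V))) (g : ℕ) (W : Bool → ℕ → α → V) (S : Set α) : Prop where
  scum : ∀ h ∈ S, ∀ b, IsScumSeq H π B g (W b · h)
  sep : ∀ h ∈ S, ∀ h' ∈ S, (∀ b t, t ≤ 2 * g + 1 → W b t h = W b t h') → h = h'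
  zero : ∀ h ∈ S, W true 0 h = W false 0 h
  last : ∀ h ∈ S, W true (2 * g + 1) h = W false (2 * g + 1) h

theorem EncodesMeets.ncard_le_of_crossing (hS : EncodesMeets H π B g W S)
    (hc : CountingSetup H π B g Δ f) {i j : ℕ} (hij : i + 2 ≤ j) (hj : j ≤ 2 * g + 1)
    (heq : ∀ h ∈ S, W true i h = W false j h) :
    S.ncard ≤ Fintype.card V *
      (Δ ^ (2 * g - 1) * (4 * (2 * g + 1 + 1) * f) ^ (2 * g + 1)) := by
  refine BoundedBy.start (W := W) true 0 ?_
  refine .up hc hS.scum true 0 i (by omega) (by omega) (by simp [extendKnown]) (by omega) ?_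
  refine .link_one true i false j (by simp [extendKnown]) heq ?_
  refine .up hc hS.scum false j (2 * g + 1) (by omega) (by omega) (by simp [extendKnown])
    (by omega) ?_
  refine .down hc hS.scum false (i + 2) j (by omega) (by omega) (by simp [extendKnown])
    (by omega) ?_
  refine .link_one false (2 * g + 1) true (2 * g + 1) (by simp [extendKnown]; omega)
    (fun h hh => (hS.last h hh).symm) ?_
  refine .link_one true 0 false 0 (by simp [extendKnown]) hS.zero ?_
  refine .gap hc hS.scum true i (2 * g + 1) (by omega) (by simp [extendKnown])
    (by simp [extendKnown]) (by omega) ?_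
  refine .gap hc hS.scum false 0 (i + 2) (by omega) (by simp [extendKnown])
    (by simp [extendKnown]; omega) (by omega) ?_
  exact .finish hc hS.sep (by rintro (_ | _) t ht <;> simp [extendKnown] <;> omega)

/-- The sequences `p` and `q` agree at `a`, and again at `u` and `v` respectively, and between
these positions some edge of `p` other than the first one is paired with an edge of `q`. -/
structure IsEar {V : Type} (B : Finset (Sym2 (Sym2 V))) (g a u v i j : ℕ) (p q : ℕ → V) :
    Prop where
  lt : a < u
  le : u ≤ v
  le_half : v ≤ g + 1
  eq_left : p a = q a
  eq_right : p u = q v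
  lt_fst : a < j
  fst_lt : j < u
  le_snd : a ≤ i
  snd_lt : i < v
  mem : s(seqEdge p j, seqEdge q i) ∈ B
  ne : ∀ t, a ≤ t → t ≤ i → p (a + 1) ≠ q t

theorem EncodesMeets.ncard_le_of_shifted_ear (hS : EncodesMeets H π B g W S)
    (hc : CountingSetup H π B g Δ f) {a u i j : ℕ}
    (hE : ∀ h ∈ S, IsEar B g a u (u + 1) i j (W true · h) (W false · h)) :
    S.ncard ≤ Fintype.card V *
      (Δ ^ (2 * g - 1) * (4 * (2 * g + 1 + 1) * f) ^ (2 * g + 1)) := by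
  rcases S.eq_empty_or_nonempty with rfl | ⟨h₀, hh₀⟩
  · simp
  obtain ⟨_, _, _, _, _, _, _, _, _, _, _⟩ := hE h₀ hh₀
  refine BoundedBy.start (W := W) false (2 * g + 1) ?_
  refine .down hc hS.scum false (u + 1) (2 * g + 1) (by omega) (by omega)
    (by simp [extendKnown]) (by omega) ?_
  refine .link_one false (u + 1) true u (by simp [extendKnown]; omega)
    (fun h hh => (hE h hh).eq_right.symm) ?_
  refine .down hc hS.scum true (a + 1) u (by omega) (by omega) (by simp [extendKnown])
    (by omega) ?_
  refine .pair hc true false j i (by simp [extendKnown]; omega) (by simp [extendKnown]; omega)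
    (by omega) (fun h hh => (hE h hh).mem) ?_
  refine .mixed hc hS.scum true false a i (by omega) (by omega) (by simp [extendKnown]; omega)
    (by simp [extendKnown]) (by omega) (fun h hh => (hE h hh).eq_left)
    (fun h hh => (hE h hh).ne) ?_
  refine .gap hc hS.scum false (i + 1) (u + 1) (by omega) (by simp [extendKnown])
    (by simp [extendKnown]; omega) (by omega) ?_
  refine .link_one false a true a (by simp [extendKnown]; omega)
    (fun h hh => (hE h hh).eq_left.symm) ?_
  refine .down hc hS.scum true 0 a (by omega) (by omega) (by simp [extendKnown]) (by omega) ?_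
  refine .link_one true 0 false 0 (by simp [extendKnown]) hS.zero ?_
  refine .gap hc hS.scum false 0 a (by omega) (by simp [extendKnown])
    (by simp [extendKnown]; omega) (by omega) ?_
  refine .link_one false (2 * g + 1) true (2 * g + 1) (by simp [extendKnown])
    (fun h hh => (hS.last h hh).symm) ?_
  refine .gap hc hS.scum true u (2 * g + 1) (by omega) (by simp [extendKnown])
    (by simp [extendKnown]) (by omega) ?_
  exact .finish hc hS.sep (by rintro (_ | _) t ht <;> simp [extendKnown] <;> omega)

theorem EncodesMeets.ncard_le_of_aligned_ear (hS : EncodesMeets H π B g W S)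
    (hc : CountingSetup H π B g Δ f) {a u i j : ℕ}
    (hE : ∀ h ∈ S, IsEar B g a u u i j (W true · h) (W false · h))
    (heq : ∀ h ∈ S, ∀ t, g + 1 ≤ t → t ≤ 2 * g + 1 → W true t h = W false t h) :
    S.ncard ≤ Fintype.card V * (Δ ^ (2 * g) * (4 * (2 * g + 1 + 1) * f) ^ (g + 1)) := by
  rcases S.eq_empty_or_nonempty with rfl | ⟨h₀, hh₀⟩
  · simp
  obtain ⟨_, _, _, _, _, _, _, _, _, _, _⟩ := hE h₀ hh₀
  refine BoundedBy.start (W := W) true (2 * g + 1) ?_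
  refine .down hc hS.scum true (a + 1) (2 * g + 1) (by omega) (by omega)
    (by simp [extendKnown]) (by omega) ?_
  refine .link_one true u false u (by simp [extendKnown]; omega) (fun h hh => (hE h hh).eq_right) ?_
  refine .link false (g + 1) (2 * g + 1) (fun t h1 h2 => ⟨true, t, by simp [extendKnown]; omega,
    fun h hh => heq h hh t h1 h2⟩) ?_
  refine .pair hc true false j i (by simp [extendKnown]; omega) (by simp [extendKnown]; omega)
    (by omega) (fun h hh => (hE h hh).mem) ?_
  refine .mixed hc hS.scum true false a i (by omega) (by omega) (by simp [extendKnown]; omega)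
    (by simp [extendKnown]) (by omega) (fun h hh => (hE h hh).eq_left)
    (fun h hh => (hE h hh).ne) ?_
  refine .gap hc hS.scum false (i + 1) u (by omega) (by simp [extendKnown])
    (by simp [extendKnown]) (by omega) ?_
  refine .link_one false a true a (by simp [extendKnown]; omega)
    (fun h hh => (hE h hh).eq_left.symm) ?_
  refine .down hc hS.scum true 0 a (by omega) (by omega) (by simp [extendKnown]) (by omega) ?_
  refine .link_one true 0 false 0 (by simp [extendKnown]) hS.zero ?_
  refine .gap hc hS.scum false 0 a (by omega) (by simp [extendKnown])
    (by simp [extendKnown]; omega) (by omega) ?_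
  refine .gap hc hS.scum false u (g + 1) (by omega) (by simp [extendKnown])
    (by simp [extendKnown]; omega) (by omega) ?_
  exact .finish hc hS.sep (by rintro (_ | _) t ht <;> simp [extendKnown] <;> omega)

theorem EncodesMeets.ncard_le_of_two_ears (hS : EncodesMeets H π B g W S)
    (hc : CountingSetup H π B g Δ f) {a u i j a' u' i' j' : ℕ} (huu : u + u' ≤ 2 * g + 1)
    (hE : ∀ h ∈ S, IsEar B g a u u i j (W true · h) (W false · h))
    (hE' : ∀ h ∈ S, IsEar B g a' u' u' i' j' (revSeq g (W true · h)) (revSeq g (W false · h))) :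
    S.ncard ≤ Fintype.card V *
      (Δ ^ (2 * g - 1) * (4 * (2 * g + 1 + 1) * f) ^ (2 * g + 1)) := by
  rcases S.eq_empty_or_nonempty with rfl | ⟨h₀, hh₀⟩
  · simp
  obtain ⟨_, _, _, _, _, _, _, _, _, _, _⟩ := hE h₀ hh₀
  obtain ⟨_, _, _, _, _, _, _, _, _, _, _⟩ := hE' h₀ hh₀
  have hpair : ∀ h ∈ S,
      s(seqEdge (W true · h) (2 * g - j'), seqEdge (W false · h) (2 * g - i')) ∈ B :=
    fun h hh => by
      have := (hE' h hh).mem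
      rwa [seqEdge_revSeq _ (by omega), seqEdge_revSeq _ (by omega)] at this
  have hne : ∀ h ∈ S, ∀ t, 2 * g + 1 - i' ≤ t → t ≤ 2 * g + 1 - a' →
      W true (2 * g + 1 - a' - 1) h ≠ W false t h := fun h hh t h1 h2 => by
    have := (hE' h hh).ne (2 * g + 1 - t) (by omega) (by omega)
    simp only [revSeq] at this
    rwa [show 2 * g + 1 - (2 * g + 1 - t) = t by omega] at this
  refine BoundedBy.start (W := W) true u ?_
  refine .up hc hS.scum true u (2 * g - a') (by omega) (by omega) (by simp [extendKnown])
    (by omega) ?_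
  refine .down hc hS.scum true (a + 1) u (by omega) (by omega) (by simp [extendKnown])
    (by omega) ?_
  refine .link_one true u false u (by simp [extendKnown]) (fun h hh => (hE h hh).eq_right) ?_
  refine .link_one true (2 * g + 1 - u') false (2 * g + 1 - u') (by simp [extendKnown]; omega)
    (fun h hh => (hE' h hh).eq_right) ?_
  refine .pair hc true false j i (by simp [extendKnown]; omega) (by simp [extendKnown]; omega)
    (by omega) (fun h hh => (hE h hh).mem) ?_
  refine .pair hc true false (2 * g - j') (2 * g - i') (by simp [extendKnown]; omega)
    (by simp [extendKnown]; omega) (by omega) hpair ?_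
  refine .mixed hc hS.scum true false a i (by omega) (by omega) (by simp [extendKnown]; omega)
    (by simp [extendKnown]) (by omega) (fun h hh => (hE h hh).eq_left)
    (fun h hh => (hE h hh).ne) ?_
  refine .mixed_rev hc hS.scum true false (2 * g + 1 - i') (2 * g + 1 - a') (by omega) (by omega)
    (by omega)
    (by rw [show 2 * g + 1 - a' - 1 = 2 * g - a' by omega]; simp [extendKnown]; omega)
    (by simp [extendKnown]; omega) (by omega) (fun h hh => (hE' h hh).eq_left) hne ?_
  refine .gap hc hS.scum false (i + 1) u (by omega) (by simp [extendKnown])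
    (by simp [extendKnown]) (by omega) ?_
  refine .gap hc hS.scum false (2 * g + 1 - u') (2 * g - i') (by omega)
    (by simp [extendKnown]) (by simp [extendKnown]) (by omega) ?_
  refine .gap hc hS.scum false u (2 * g + 1 - u') (by omega)
    (by simp [extendKnown]) (by simp [extendKnown]) (by omega) ?_
  refine .link_one false a true a (by simp [extendKnown]; omega)
    (fun h hh => (hE h hh).eq_left.symm) ?_
  refine .down hc hS.scum true 0 a (by omega) (by omega) (by simp [extendKnown])
    (by omega) ?_
  refine .link_one true 0 false 0 (by simp [extendKnown]) hS.zero ?_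
  refine .gap hc hS.scum false 0 a (by omega) (by simp [extendKnown])
    (by simp [extendKnown]; omega) (by omega) ?_
  refine .link_one false (2 * g + 1 - a') true (2 * g + 1 - a') (by simp [extendKnown]; omega)
    (fun h hh => (hE' h hh).eq_left.symm) ?_
  refine .up hc hS.scum true (2 * g + 1 - a') (2 * g + 1) (by omega) (by omega)
    (by simp [extendKnown]) (by omega) ?_
  refine .link_one true (2 * g + 1) false (2 * g + 1) (by simp [extendKnown]) hS.last ?_
  refine .gap hc hS.scum false (2 * g + 1 - a') (2 * g + 1) (by omega)
    (by simp [extendKnown]; omega) (by simp [extendKnown]) (by omega) ?_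
  exact .finish hc hS.sep (by rintro (_ | _) t ht <;> simp [extendKnown] <;> omega)

/-- The sequences `p` and `q` agree at `a` and `b`, which lie on both sides of the middle edge,
and the middle edge of `p` is paired with an edge of `q` strictly between these positions. -/
structure IsMiddlePair {V : Type} (B : Finset (Sym2 (Sym2 V))) (g a b i : ℕ) (p q : ℕ → V) :
    Prop where
  lt : a < g
  gt : g + 1 < b
  le : b ≤ 2 * g + 1
  eq_left : p a = q a
  eq_right : p b = q b
  lt_fst : a < i
  fst_lt : i + 1 < b
  mem : s(seqEdge p g, seqEdge q i) ∈ B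
  ne : ∀ t, a ≤ t → t ≤ g → q (a + 1) ≠ p t
  ne' : ∀ t, g + 1 ≤ t → t ≤ b → q (b - 1) ≠ p t

theorem EncodesMeets.ncard_le_of_middlePair (hS : EncodesMeets H π B g W S)
    (hc : CountingSetup H π B g Δ f) {a b i : ℕ}
    (hE : ∀ h ∈ S, IsMiddlePair B g a b i (W true · h) (W false · h)) :
    S.ncard ≤ Fintype.card V *
      (Δ ^ (2 * g - 1) * (4 * (2 * g + 1 + 1) * f) ^ (2 * g + 1)) := by
  rcases S.eq_empty_or_nonempty with rfl | ⟨h₀, hh₀⟩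
  · simp
  obtain ⟨_, _, _, _, _, _, _, _, _, _⟩ := hE h₀ hh₀
  refine BoundedBy.start (W := W) false (a + 1) ?_
  refine .up hc hS.scum false (a + 1) (b - 1) (by omega) (by omega)
    (by simp [extendKnown]) (by omega) ?_
  refine .pair hc false true i g (by simp [extendKnown]; omega)
    (by simp [extendKnown]; omega) (by omega) (fun h hh => by
      rw [Sym2.eq_swap]
      exact (hE h hh).mem) ?_
  refine .mixed hc hS.scum false true a g (by omega) (by omega) (by simp [extendKnown])
    (by simp [extendKnown]) (by omega) (fun h hh => (hE h hh).eq_left.symm)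
    (fun h hh => (hE h hh).ne) ?_
  refine .mixed_rev hc hS.scum false true (g + 1) b (by omega) (by omega) (by omega)
    (by simp [extendKnown]; omega) (by simp [extendKnown]) (by omega)
    (fun h hh => (hE h hh).eq_right.symm) (fun h hh => (hE h hh).ne') ?_
  refine .down hc hS.scum true 0 a (by omega) (by omega) (by simp [extendKnown]; omega)
    (by omega) ?_
  refine .up hc hS.scum true b (2 * g + 1) (by omega) (by omega) (by simp [extendKnown]; omega)
    (by omega) ?_
  refine .link_one true 0 false 0 (by simp [extendKnown]) hS.zero ?_
  refine .link_one true a false a (by simp [extendKnown])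
    (fun h hh => (hE h hh).eq_left) ?_
  refine .link_one true b false b (by simp [extendKnown]; omega)
    (fun h hh => (hE h hh).eq_right) ?_
  refine .link_one true (2 * g + 1) false (2 * g + 1) (by simp [extendKnown]; omega) hS.last ?_
  refine .gap hc hS.scum false 0 a (by omega) (by simp [extendKnown])
    (by simp [extendKnown]) (by omega) ?_
  refine .gap hc hS.scum false b (2 * g + 1) (by omega) (by simp [extendKnown])
    (by simp [extendKnown]) (by omega) ?_
  exact .finish hc hS.sep (by rintro (_ | _) t ht <;> simp [extendKnown] <;> omega)

end Counting

/-! ### Every meet belongs to one of the families -/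

theorem exists_last_before {P : ℕ → Prop} {t : ℕ} (h0 : P 0) (ht : ¬ P t) :
    ∃ a < t, P a ∧ ∀ s, a < s → s ≤ t → ¬ P s := by
  induction t with
  | zero => exact absurd h0 ht
  | succ t ih =>
    by_cases h : P t
    · refine ⟨t, by omega, h, fun s h1 h2 => ?_⟩
      rwa [show s = t + 1 by omega]
    · obtain ⟨a, ha, hPa, hmax⟩ := ih h
      refine ⟨a, by omega, hPa, fun s h1 h2 => ?_⟩
      rcases (show s ≤ t ∨ s = t + 1 by omega) with h3 | rfl
      exacts [hmax s h1 h3, ht]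

theorem exists_first_after {P : ℕ → Prop} {t c : ℕ} (hc : P c) (ht : ¬ P t) (htc : t ≤ c) :
    ∃ u, t < u ∧ u ≤ c ∧ P u ∧ ∀ s, t ≤ s → s < u → ¬ P s := by
  classical
  have hex : ∃ u, t ≤ u ∧ P u := ⟨c, htc, hc⟩
  obtain ⟨h1, h2⟩ := Nat.find_spec hex
  refine ⟨Nat.find hex, lt_of_le_of_ne h1 ?_, Nat.find_min' hex ⟨htc, hc⟩, h2,
    fun s h3 h4 h5 => Nat.find_min hex h4 ⟨h3, h5⟩⟩
  intro h
  exact ht (h ▸ h2)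

section Classification

variable {V : Type} {H : SimpleGraph V} {π : Sym2 V → ℕ} {B : Finset (Sym2 (Sym2 V))} {g : ℕ}
  {p q : ℕ → V}

theorem IsScumSeq.exists_isEar (hB : IsDoubleBlockingSet H π (2 * g + 1) B)
    (hπ : Set.InjOn π H.edgeSet) (hp : IsScumSeq H π B g p) (hq : IsScumSeq H π B g q)
    {a u v : ℕ} (hau : a < u) (huv : u ≤ v) (hv : v ≤ g + 1) (hav : a + 2 ≤ v) (h0 : p a = q a)
    (h1 : p u = q v) (hpq : ∀ s, a < s → s < u → ∀ t, a ≤ t → t ≤ v → p s ≠ q t) :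
    ∃ i j, IsEar B g a u v i j p q := by
  classical
  have hdisj : ∀ s t, a ≤ s → s < u → a ≤ t → t < v → seqEdge p s ≠ seqEdge q t := by
    intro s t hs hs' ht ht' heq
    have key : ∀ r, a < r → r < u → p r ∉ seqEdge q t := fun r hr hr' hmem => by
      rcases Sym2.mem_iff.1 hmem with h | h
      · exact hpq r hr hr' t ht ht'.le h
      · exact hpq r hr hr' (t + 1) (by omega) (by omega) h
    have hs0 : s = a := by
      by_contra hne
      exact key s (by omega) hs' (heq ▸ Sym2.mem_mk_left _ _)
    have hs1 : s + 1 = u := by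
      by_contra hne
      exact key (s + 1) (by omega) (by omega) (heq ▸ Sym2.mem_mk_right _ _)
    rw [seqEdge, hs1, hs0, h0, h1] at heq
    rcases Sym2.eq_iff.1 heq with ⟨h2, h3⟩ | ⟨h2, h3⟩
    · have := hq.inj _ _ (by omega) (by omega) h2
      have := hq.inj _ _ (by omega) (by omega) h3
      omega
    · have := hq.inj _ _ (by omega) (by omega) h2
      omega
  have build : ∀ i j, a < j → j < u → a ≤ i → i < v → s(seqEdge p j, seqEdge q i) ∈ B →
      ∃ i j, IsEar B g a u v i j p q := fun i j hj hj' hi hi' hm =>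
    ⟨i, j, hau, huv, hv, h0, h1, hj, hj', hi, hi', hm,
      fun t ht ht' => hpq (a + 1) (by omega) (by omega) t ht (by omega)⟩
  have padj : ∀ s, a ≤ s → s < u → H.Adj (p s) (p (s + 1)) := fun s _ hs => hp.adj s (by omega)
  have qadj : ∀ s, a ≤ s → s < v → H.Adj (q s) (q (s + 1)) := fun s _ hs => hq.adj s (by omega)
  obtain ⟨e, he, hmax⟩ := (pairEdges p q a u a v).exists_max_image π
    ⟨_, mem_pairEdges.2 (Or.inl ⟨a, le_rfl, hau, rfl⟩)⟩
  rcases mem_pairEdges.1 he with ⟨j, hj, hj', rfl⟩ | ⟨i, hi, hi', rfl⟩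
  · have hpp : ∀ s, a ≤ s → s < u → s(seqEdge p j, seqEdge p s) ∉ B := fun s =>
      hp.notMem_of_latest hB hπ (by omega) hj hj'
        (fun s h2 h3 => hmax _ (mem_pairEdges.2 (Or.inl ⟨s, h2, h3, rfl⟩)))
    obtain ⟨e1, he1, e2, he2, hne, hB1, hB2⟩ := (hB.exists_block hπ padj qadj (by omega) hj hj' h0
      h1 (fun s _ h3 h4 => hp.seqEdge_ne (by omega) (by omega) h4)
      (fun s h2 h3 => (hdisj j s hj hj' h2 h3).symm) hmax).2 (by omega)
    rcases mem_pairEdges.1 he1 with ⟨s, h2, h3, rfl⟩ | ⟨i1, hi1, hi1', rfl⟩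
    · exact absurd hB1 (hpp s h2 h3)
    rcases mem_pairEdges.1 he2 with ⟨s, h2, h3, rfl⟩ | ⟨i2, hi2, hi2', rfl⟩
    · exact absurd hB2 (hpp s h2 h3)
    rcases hj.lt_or_eq with hj | rfl
    · exact build i1 j hj hj' hi1 hi1' hB1
    · have key : ∀ i, a < i → i < v → s(seqEdge p a, seqEdge q i) ∉ B := fun i h2 h3 h4 =>
        hq.left i a (by omega) h2 _ (Sym2.eq_swap ▸ h4) (h0 ▸ Sym2.mem_mk_left _ _)
      have e1 : i1 = a := by
        by_contra h
        exact key i1 (by omega) hi1' hB1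
      have e2 : i2 = a := by
        by_contra h
        exact key i2 (by omega) hi2' hB2
      exact absurd (by rw [e1, e2]) hne
  · have hmax' : ∀ e ∈ pairEdges q p a v a u, π e ≤ π (seqEdge q i) := fun e he =>
      hmax e (mem_pairEdges.2 (mem_pairEdges.1 he).symm)
    have hqq : ∀ s, a ≤ s → s < v → s(seqEdge q i, seqEdge q s) ∉ B := fun s =>
      hq.notMem_of_latest hB hπ (by omega) hi hi'
        (fun s h2 h3 => hmax _ (mem_pairEdges.2 (Or.inr ⟨s, h2, h3, rfl⟩)))
    obtain ⟨e1, he1, e2, he2, hne, hB1, hB2⟩ := (hB.exists_block hπ qadj padj (by omega) hi hi'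
      h0.symm h1.symm (fun s _ h3 h4 => hq.seqEdge_ne (by omega) (by omega) h4)
      (fun s h2 h3 => hdisj s i h2 h3 hi hi') hmax').2 (by omega)
    rcases mem_pairEdges.1 he1 with ⟨s, h2, h3, rfl⟩ | ⟨j1, hj1, hj1', rfl⟩
    · exact absurd hB1 (hqq s h2 h3)
    rcases mem_pairEdges.1 he2 with ⟨s, h2, h3, rfl⟩ | ⟨j2, hj2, hj2', rfl⟩
    · exact absurd hB2 (hqq s h2 h3)
    rcases hj1.lt_or_eq with hj1 | rfl
    · exact build i j1 hj1 hj1' hi hi' (Sym2.eq_swap ▸ hB1)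
    · refine build i j2 (lt_of_le_of_ne hj2 ?_) hj2' hi hi' (Sym2.eq_swap ▸ hB2)
      rintro rfl
      exact hne rfl

theorem IsScumSeq.exists_aligned_ear (hB : IsDoubleBlockingSet H π (2 * g + 1) B)
    (hπ : Set.InjOn π H.edgeSet) (hp : IsScumSeq H π B g p) (hq : IsScumSeq H π B g q)
    (hal : ∀ i j, i ≤ 2 * g + 1 → j ≤ 2 * g + 1 → p i = q j → i = j) (h0 : p 0 = q 0) {c t : ℕ}
    (hc : c ≤ g + 1) (hpc : p c = q c) (htc : t < c) (ht : p t ≠ q t) :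
    ∃ a u i j, u ≤ c ∧ IsEar B g a u u i j p q := by
  obtain ⟨a, hat, ha, hmax⟩ := exists_last_before (P := fun s => p s = q s) h0 ht
  obtain ⟨u, htu, huc, hu, hmin⟩ := exists_first_after (P := fun s => p s = q s) hpc ht htc.le
  obtain ⟨i, j, hE⟩ := hp.exists_isEar hB hπ hq (show a < u by omega) le_rfl (by omega) (by omega)
    ha hu fun s h1 h2 r h3 h4 h5 => by
      obtain rfl := hal s r (by omega) (by omega) h5
      rcases le_total s t with h | h
      exacts [hmax s h1 h h5, hmin s h h2 h5]
  exact ⟨a, u, i, j, huc, hE⟩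

theorem IsScumSeq.exists_middlePair (hB : IsDoubleBlockingSet H π (2 * g + 1) B)
    (hπ : Set.InjOn π H.edgeSet) (hp : IsScumSeq H π B g p) (hq : IsScumSeq H π B g q)
    (hal : ∀ i j, i ≤ 2 * g + 1 → j ≤ 2 * g + 1 → p i = q j → i = j) (h0 : p 0 = q 0)
    (h1 : p (2 * g + 1) = q (2 * g + 1)) (hg : p g ≠ q g) (hg' : p (g + 1) ≠ q (g + 1))
    (hle : π (seqEdge q g) ≤ π (seqEdge p g)) :
    ∃ a b i, IsMiddlePair B g a b i p q := by
  classical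
  obtain ⟨a, hag, ha, hmax⟩ := exists_last_before (P := fun s => p s = q s) h0 hg
  obtain ⟨b, hgb, hbk, hb, hmin⟩ :=
    exists_first_after (P := fun s => p s = q s) h1 hg' (by omega)
  have hne : ∀ s t, a < s → s < b → t ≤ 2 * g + 1 → p t ≠ q s := fun s t h2 h3 h4 h5 => by
    obtain rfl := hal t s h4 (by omega) h5
    rcases le_or_gt t g with h | h
    exacts [hmax t h2 h h5, hmin t h h3 h5]
  have hgq : ∀ s, a ≤ s → s < b → seqEdge q s ≠ seqEdge p g := fun s h2 h3 h4 => by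
    have hm : p g ∈ seqEdge q s := h4 ▸ Sym2.mem_mk_left _ _
    rcases Sym2.mem_iff.1 hm with h | h
    · exact hg (hal g s (by omega) (by omega) h ▸ h)
    · exact hg (hal g (s + 1) (by omega) (by omega) h ▸ h)
  obtain ⟨e, he, heB⟩ := (hB.exists_block hπ (x := p) (y := q) (a := a) (b := b) (c := a) (d := b)
    (t := g) (fun s _ h3 => hp.adj s (by omega)) (fun s _ h3 => hq.adj s (by omega)) (by omega)
    (by omega) (by omega) ha hb (fun s _ h3 h4 => hp.seqEdge_ne (by omega) (by omega) h4) hgq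
    (fun e he => by
      rcases mem_pairEdges.1 he with ⟨s, h2, h3, rfl⟩ | ⟨s, h2, h3, rfl⟩
      · exact hp.mid s (by omega)
      · exact (hq.mid s (by omega)).trans hle)).1 (by omega)
  rcases mem_pairEdges.1 he with ⟨s, h2, h3, rfl⟩ | ⟨i, hi, hi', rfl⟩
  · exact absurd heB (hp.notMem_of_latest hB hπ hbk hag.le (by omega)
      (fun s _ h5 => hp.mid s (by omega)) h2 h3)
  refine ⟨a, b, i, hag, hgb, hbk, ha, hb, lt_of_le_of_ne hi ?_, lt_of_le_of_ne hi' ?_, heB,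
    fun t _ h3 => (hne (a + 1) t (by omega) (by omega) (by omega)).symm,
    fun t _ h3 => (hne (b - 1) t (by omega) (by omega) (by omega)).symm⟩
  · rintro rfl
    exact hp.left g a le_rfl hag _ heB (ha ▸ Sym2.mem_mk_left _ _)
  · intro h
    have hm : q (i + 1) ∈ seqEdge q i := Sym2.mem_mk_right _ _
    rw [show i + 1 = b from h, ← hb] at hm
    exact hp.right g b le_rfl (by omega) hbk _ heB hm

/-- The pair `p, q` belongs to one of the families that are counted above. -/
def HasShape {V : Type} (B : Finset (Sym2 (Sym2 V))) (g : ℕ) (p q : ℕ → V) : Prop :=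
  (∃ i j, i + 2 ≤ j ∧ j ≤ 2 * g + 1 ∧ p i = q j) ∨
  (∃ a u i j, IsEar B g a u (u + 1) i j p q) ∨
  (∃ a u i j, IsEar B g a u u i j p q ∧ ∀ t, g + 1 ≤ t → t ≤ 2 * g + 1 → p t = q t) ∨
  (∃ a u i j, IsEar B g a u u i j p q ∧ ∃ a' u' i' j', u + u' ≤ 2 * g + 1 ∧
    IsEar B g a' u' u' i' j' (revSeq g p) (revSeq g q)) ∨
  (∃ a b i, IsMiddlePair B g a b i p q)

theorem IsScumSeq.hasShape_of_shift (hB : IsDoubleBlockingSet H π (2 * g + 1) B)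
    (hπ : Set.InjOn π H.edgeSet) (hp : IsScumSeq H π B g p) (hq : IsScumSeq H π B g q)
    (hnear : ∀ i j, i ≤ 2 * g + 1 → j ≤ 2 * g + 1 → p i = q j → i ≤ j + 1 ∧ j ≤ i + 1)
    (h0 : p 0 = q 0) {u : ℕ} (hu : u ≤ g) (hpu : p u = q (u + 1))
    (hmin : ∀ t < u, p t ≠ q (t + 1) ∧ q t ≠ p (t + 1)) : HasShape B g p q := by
  obtain ⟨a, hau, ha, hmax⟩ := exists_last_before (P := fun s => p s = q s) h0
    (show ¬ p u = q u from fun h => by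
      have := hq.inj _ _ (by omega) (by omega) (h.symm.trans hpu)
      omega)
  obtain ⟨i, j, hE⟩ := hp.exists_isEar hB hπ hq hau (Nat.le_succ u) (by omega) (by omega)
    ha hpu fun s h1 h2 t h3 h4 h5 => by
      have := hnear s t (by omega) (by omega) h5
      rcases (show t = s ∨ t = s + 1 ∨ s = t + 1 by omega) with rfl | rfl | rfl
      · exact hmax t h1 h2.le h5
      · exact (hmin s h2).1 h5
      · exact (hmin t (by omega)).2 h5.symm
  exact Or.inr (Or.inl ⟨a, u, i, j, hE⟩)

theorem IsScumSeq.hasShape_of_exists_shift (hB : IsDoubleBlockingSet H π (2 * g + 1) B)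
    (hπ : Set.InjOn π H.edgeSet) (hp : IsScumSeq H π B g p) (hq : IsScumSeq H π B g q)
    (hnear : ∀ i j, i ≤ 2 * g + 1 → j ≤ 2 * g + 1 → p i = q j → i ≤ j + 1 ∧ j ≤ i + 1)
    (h0 : p 0 = q 0) {t : ℕ} (ht : t ≤ g) (h : p t = q (t + 1) ∨ q t = p (t + 1)) :
    HasShape B g p q ∨ HasShape B g q p := by
  classical
  have hex : ∃ t, p t = q (t + 1) ∨ q t = p (t + 1) := ⟨t, h⟩
  have hle : Nat.find hex ≤ g := (Nat.find_min' hex h).trans ht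
  have hmin : ∀ s < Nat.find hex, p s ≠ q (s + 1) ∧ q s ≠ p (s + 1) := fun s hs =>
    not_or.1 (Nat.find_min hex hs)
  rcases Nat.find_spec hex with h1 | h1
  · exact Or.inl (hp.hasShape_of_shift hB hπ hq hnear h0 hle h1 hmin)
  · exact Or.inr (hq.hasShape_of_shift hB hπ hp
      (fun i j hi hj hij => (hnear j i hj hi hij.symm).symm) h0.symm hle h1
      fun s hs => (hmin s hs).symm)

theorem IsScumSeq.hasShape_of_aligned (hB : IsDoubleBlockingSet H π (2 * g + 1) B)
    (hπ : Set.InjOn π H.edgeSet) (hp : IsScumSeq H π B g p) (hq : IsScumSeq H π B g q)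
    (hal : ∀ i j, i ≤ 2 * g + 1 → j ≤ 2 * g + 1 → p i = q j → i = j) (h0 : p 0 = q 0)
    (h1 : p (2 * g + 1) = q (2 * g + 1)) {t : ℕ} (ht : t ≤ 2 * g + 1) (hpt : p t ≠ q t) :
    HasShape B g p q ∨ HasShape B g q p ∨ HasShape B g (revSeq g p) (revSeq g q) := by
  by_cases hmid : ∃ c, g ≤ c ∧ c ≤ g + 1 ∧ p c = q c
  · obtain ⟨c, hgc, hcg, hc⟩ := hmid
    have hal' : ∀ i j, i ≤ 2 * g + 1 → j ≤ 2 * g + 1 → revSeq g p i = revSeq g q j → i = j :=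
      fun i j hi hj hij => by
        have := hal _ _ (by omega) (by omega) hij
        omega
    have hright : ∀ t, c < t → t ≤ 2 * g + 1 → p t ≠ q t →
        ∃ a u i j, u ≤ 2 * g + 1 - c ∧ IsEar B g a u u i j (revSeq g p) (revSeq g q) :=
      fun t h2 h3 h4 => hp.rev.exists_aligned_ear hB hπ hq.rev hal' h1 (c := 2 * g + 1 - c)
        (t := 2 * g + 1 - t) (by omega)
        (by rwa [revSeq, revSeq, show 2 * g + 1 - (2 * g + 1 - c) = c by omega]) (by omega)
        (by rwa [revSeq, revSeq, show 2 * g + 1 - (2 * g + 1 - t) = t by omega])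
    by_cases hL : ∃ t, t < c ∧ p t ≠ q t
    · obtain ⟨s, hs, hps⟩ := hL
      obtain ⟨a, u, i, j, hu, hE⟩ := hp.exists_aligned_ear hB hπ hq hal h0 hcg hc hs hps
      refine Or.inl ?_
      by_cases hR : ∃ t, c < t ∧ t ≤ 2 * g + 1 ∧ p t ≠ q t
      · obtain ⟨r, hr, hr', hpr⟩ := hR
        obtain ⟨a', u', i', j', hu', hE'⟩ := hright r hr hr' hpr
        exact Or.inr (Or.inr (Or.inr (Or.inl
          ⟨a, u, i, j, hE, a', u', i', j', by omega, hE'⟩)))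
      · push Not at hR
        refine Or.inr (Or.inr (Or.inl ⟨a, u, i, j, hE, fun r h2 h3 => ?_⟩))
        rcases (show c < r ∨ r = c by omega) with h | rfl
        exacts [hR r h h3, hc]
    · push Not at hL
      have hct : c < t := by
        by_contra h
        rcases (show t < c ∨ t = c by omega) with h | rfl
        exacts [hpt (hL t h), hpt hc]
      obtain ⟨a, u, i, j, -, hE⟩ := hright t hct ht hpt
      refine Or.inr (Or.inr (Or.inr (Or.inr (Or.inl ⟨a, u, i, j, hE, fun r h2 h3 => ?_⟩))))
      rw [revSeq, revSeq]
      rcases (show 2 * g + 1 - r < c ∨ 2 * g + 1 - r = c by omega) with h | h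
      · exact hL _ h
      · rw [h, hc]
  · push Not at hmid
    have hg := hmid g le_rfl (Nat.le_succ g)
    have hg' := hmid (g + 1) (Nat.le_succ g) le_rfl
    rcases le_total (π (seqEdge q g)) (π (seqEdge p g)) with hle | hle
    · exact Or.inl (Or.inr (Or.inr (Or.inr (Or.inr
        (hp.exists_middlePair hB hπ hq hal h0 h1 hg hg' hle)))))
    · exact Or.inr (Or.inl (Or.inr (Or.inr (Or.inr (Or.inr
        (hq.exists_middlePair hB hπ hp (fun i j hi hj hij => (hal j i hj hi hij.symm).symm)
          h0.symm h1.symm hg.symm hg'.symm hle))))))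

theorem IsScumSeq.exists_hasShape (hB : IsDoubleBlockingSet H π (2 * g + 1) B)
    (hπ : Set.InjOn π H.edgeSet) (hp : IsScumSeq H π B g p) (hq : IsScumSeq H π B g q)
    (h0 : p 0 = q 0) (h1 : p (2 * g + 1) = q (2 * g + 1)) {t : ℕ} (ht : t ≤ 2 * g + 1)
    (hpt : p t ≠ q t) :
    (HasShape B g p q ∨ HasShape B g q p) ∨
      HasShape B g (revSeq g p) (revSeq g q) ∨ HasShape B g (revSeq g q) (revSeq g p) := by
  by_cases hnear : ∀ i j, i ≤ 2 * g + 1 → j ≤ 2 * g + 1 → p i = q j → i ≤ j + 1 ∧ j ≤ i + 1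
  · by_cases hshift : ∃ t, t ≤ 2 * g ∧ (p t = q (t + 1) ∨ q t = p (t + 1))
    · obtain ⟨s, hs, hps⟩ := hshift
      rcases le_or_gt s g with hsg | hsg
      · exact Or.inl (hp.hasShape_of_exists_shift hB hπ hq hnear h0 hsg hps)
      · refine Or.inr (hp.rev.hasShape_of_exists_shift hB hπ hq.rev (fun i j hi hj hij => ?_) h1
          (t := 2 * g - s) (by omega) ?_)
        · have := hnear _ _ (by omega) (by omega) hij
          omega
        · simp only [revSeq]
          rw [show 2 * g + 1 - (2 * g - s) = s + 1 by omega,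
            show 2 * g + 1 - (2 * g - s + 1) = s by omega]
          exact hps.symm.imp Eq.symm Eq.symm
    · push Not at hshift
      have hal : ∀ i j, i ≤ 2 * g + 1 → j ≤ 2 * g + 1 → p i = q j → i = j := by
        intro i j hi hj hij
        have := hnear i j hi hj hij
        rcases (show i = j ∨ j = i + 1 ∨ i = j + 1 by omega) with h | rfl | rfl
        · exact h
        · exact absurd hij (hshift i (by omega)).1
        · exact absurd hij.symm (hshift j (by omega)).2
      rcases hp.hasShape_of_aligned hB hπ hq hal h0 h1 ht hpt with h | h | h
      exacts [Or.inl (Or.inl h), Or.inl (Or.inr h), Or.inr (Or.inl h)]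
  · push Not at hnear
    obtain ⟨i, j, hi, hj, hij, hfar⟩ := hnear
    refine Or.inl ?_
    rcases le_or_gt i (j + 1) with h | h
    · exact Or.inl (Or.inl ⟨i, j, hfar h, hj, hij⟩)
    · exact Or.inr (Or.inl ⟨j, i, h, hi, hij.symm⟩)


/-- Two distinct SCUM paths with common ends form a cycle, so they yield a pair of `B`. -/
theorem IsScumSeq.exists_mem_block (hB : IsDoubleBlockingSet H π (2 * g + 1) B)
    (hp : IsScumSeq H π B g p) (hq : IsScumSeq H π B g q) (h0 : p 0 = q 0)
    (h1 : p (2 * g + 1) = q (2 * g + 1)) {t : ℕ} (ht : t ≤ 2 * g + 1) (hpt : p t ≠ q t) :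
    ∃ e e', s(e, e') ∈ B := by
  classical
  have hex : ∃ t, p t ≠ q t := ⟨t, hpt⟩
  obtain ⟨a, ha⟩ : ∃ a, Nat.find hex = a + 1 :=
    Nat.exists_eq_succ_of_ne_zero fun h => Nat.find_spec hex (by rw [h]; exact h0)
  have hlt : ∀ s, s ≤ a → p s = q s := fun s hs => not_not.1 (Nat.find_min hex (by omega))
  have hne : p (a + 1) ≠ q (a + 1) := ha ▸ Nat.find_spec hex
  have hat : a + 1 ≤ t := ha ▸ Nat.find_min' hex hpt
  obtain ⟨w, c, hc, -, -, hlen⟩ := exists_isCycle_of_seqs (H := H) (x := p) (y := q) (a := 0)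
    (b := 2 * g + 1) (c := 0) (d := 2 * g + 1) (t := a) (fun s _ hs => hp.adj s hs)
    (fun s _ hs => hq.adj s hs) (by omega) (by omega) (by omega) h0 h1
    (fun s _ hs hsa => hp.seqEdge_ne hs (by omega) hsa) fun s _ hs heq => by
      rcases Sym2.eq_iff.1 heq with ⟨h2, h3⟩ | ⟨h2, h3⟩
      · rw [hlt a le_rfl] at h2
        obtain rfl := hq.inj s a (by omega) (by omega) h2
        exact hne h3.symm
      · rw [hlt a le_rfl] at h3
        have hsa := hq.inj (s + 1) a (by omega) (by omega) h3
        rw [← hlt s (by omega)] at h2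
        have := hp.inj s (a + 1) (by omega) (by omega) h2
        omega
  obtain ⟨b, hb, e, e', rfl, -⟩ := hB.2.1 w c hc (by omega)
  exact ⟨e, e', hb⟩

end Classification

/-! ### Counting all meets -/

theorem ncard_le_of_or {α : Type} [Finite α] {S : Set α} {P Q : α → Prop} {C D : ℕ}
    (hcov : ∀ h ∈ S, P h ∨ Q h) (hP : ∀ T ⊆ S, (∀ h ∈ T, P h) → T.ncard ≤ C)
    (hQ : ∀ T ⊆ S, (∀ h ∈ T, Q h) → T.ncard ≤ D) : S.ncard ≤ C + D := by
  have hsub : S ⊆ {h ∈ S | P h} ∪ {h ∈ S | Q h} := fun h hh =>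
    (hcov h hh).imp (fun h1 => ⟨hh, h1⟩) fun h1 => ⟨hh, h1⟩
  exact (Set.ncard_le_ncard hsub (Set.toFinite _)).trans ((Set.ncard_union_le _ _).trans
    (Nat.add_le_add (hP _ (fun h hh => hh.1) fun h hh => hh.2)
      (hQ _ (fun h hh => hh.1) fun h hh => hh.2)))

theorem ncard_le_of_tuple {α : Type} [Finite α] {S : Set α} {n m N C : ℕ}
    (R : (Fin n → ℕ) → α → Prop) (hn : n ≤ m)
    (hcov : ∀ h ∈ S, ∃ x : Fin n → ℕ, R x h ∧ ∀ i, x i ≤ N)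
    (hC : ∀ x, ∀ T ⊆ S, (∀ h ∈ T, R x h) → T.ncard ≤ C) : S.ncard ≤ (N + 1) ^ m * C := by
  have := ncard_le_of_cover (Fintype.piFinset fun _ : Fin n => Finset.range (N + 1)) R C
    (fun h hh => by
      obtain ⟨x, hx, hle⟩ := hcov h hh
      exact ⟨x, Fintype.mem_piFinset.2 fun i => Finset.mem_range.2 (Nat.lt_succ_of_le (hle i)), hx⟩)
    fun x _ => hC x
  rw [Fintype.card_piFinset_const, Finset.card_range] at this
  exact this.trans (Nat.mul_le_mul_right _ (Nat.pow_le_pow_right (by omega) hn))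

section Meets

variable {V α : Type} {g Δ f : ℕ} {W : Bool → ℕ → α → V} {S T : Set α} {H : SimpleGraph V}
  {π : Sym2 V → ℕ} {B : Finset (Sym2 (Sym2 V))}

theorem EncodesMeets.mono (hS : EncodesMeets H π B g W S) (hT : T ⊆ S) :
    EncodesMeets H π B g W T where
  scum h hh := hS.scum h (hT hh)
  sep h hh h' hh' := hS.sep h (hT hh) h' (hT hh')
  zero h hh := hS.zero h (hT hh)
  last h hh := hS.last h (hT hh)

theorem EncodesMeets.swap (hS : EncodesMeets H π B g W S) :
    EncodesMeets H π B g (fun b => W !b) S where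
  scum h hh b := hS.scum h hh !b
  sep h hh h' hh' hW := hS.sep h hh h' hh' fun b t ht => by simpa using hW (!b) t ht
  zero h hh := (hS.zero h hh).symm
  last h hh := (hS.last h hh).symm

theorem EncodesMeets.rev (hS : EncodesMeets H π B g W S) :
    EncodesMeets H π B g (fun b t h => revSeq g (W b · h) t) S where
  scum h hh b := (hS.scum h hh b).rev
  sep h hh h' hh' hW := hS.sep h hh h' hh' fun b t ht => by
    simpa only [revSeq, Nat.sub_sub_self ht] using hW b (2 * g + 1 - t) (by omega)
  zero h hh := hS.last h hh
  last h hh := by simpa [revSeq] using hS.zero h hh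

variable [Finite α] [Fintype V]

theorem EncodesMeets.ncard_le_of_hasShape (hS : EncodesMeets H π B g W S)
    (hc : CountingSetup H π B g Δ f)
    (hH : ∀ h ∈ S, HasShape B g (W true · h) (W false · h)) :
    S.ncard ≤ 5 * ((2 * g + 1 + 1) ^ 8 *
      (Fintype.card V * (Δ ^ (2 * g - 1) * (4 * (2 * g + 1 + 1) * f) ^ (2 * g + 1)) +
        Fintype.card V * (Δ ^ (2 * g) * (4 * (2 * g + 1 + 1) * f) ^ (g + 1)))) := by
  set X := Fintype.card V * (Δ ^ (2 * g - 1) * (4 * (2 * g + 1 + 1) * f) ^ (2 * g + 1)) with hX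
  set Y := Fintype.card V * (Δ ^ (2 * g) * (4 * (2 * g + 1 + 1) * f) ^ (g + 1)) with hY
  have hXY : X ≤ X + Y := Nat.le_add_right _ _
  have hYX : Y ≤ X + Y := Nat.le_add_left _ _
  set D := (2 * g + 1 + 1) ^ 8 * (X + Y) with hD
  refine (ncard_le_of_or (C := D) (D := D + (D + (D + D))) hH ?_ fun T hT hH =>
    ncard_le_of_or hH ?_ fun U hU hH => ncard_le_of_or hH ?_ fun U' hU' hH =>
      ncard_le_of_or hH ?_ ?_).trans (by omega)
  · intro T hT hH
    refine ncard_le_of_tuple (n := 2) (fun x h => x 0 + 2 ≤ x 1 ∧ x 1 ≤ 2 * g + 1 ∧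
      W true (x 0) h = W false (x 1) h) (by omega) (fun h hh => ?_) fun x U hU hR => ?_
    · obtain ⟨i, j, h1, h2, h3⟩ := hH h hh
      exact ⟨![i, j], ⟨h1, h2, h3⟩, by simp [Fin.forall_fin_succ]; omega⟩
    · rcases U.eq_empty_or_nonempty with rfl | ⟨h₀, hh₀⟩
      · simp
      · exact ((hS.mono (hU.trans hT)).ncard_le_of_crossing hc (hR h₀ hh₀).1 (hR h₀ hh₀).2.1
          fun h hh => (hR h hh).2.2).trans hXY
  · intro U hU hH
    refine ncard_le_of_tuple (n := 4) (fun x h => IsEar B g (x 0) (x 1) (x 1 + 1) (x 2) (x 3)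
      (W true · h) (W false · h)) (by omega) (fun h hh => ?_) fun x U' hU' hR =>
      ((hS.mono (hU'.trans (hU.trans hT))).ncard_le_of_shifted_ear hc hR).trans hXY
    obtain ⟨a, u, i, j, hE⟩ := hH h hh
    obtain ⟨_, _, _, _, _, _, _, _, _, _, _⟩ := id hE
    exact ⟨![a, u, i, j], hE, by simp [Fin.forall_fin_succ]; omega⟩
  · intro U' hU' hH
    refine ncard_le_of_tuple (n := 4) (fun x h => IsEar B g (x 0) (x 1) (x 1) (x 2) (x 3)
      (W true · h) (W false · h) ∧ ∀ t, g + 1 ≤ t → t ≤ 2 * g + 1 → W true t h = W false t h)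
      (by omega) (fun h hh => ?_) fun x Z hZ hR =>
      ((hS.mono (hZ.trans (hU'.trans (hU.trans hT)))).ncard_le_of_aligned_ear hc
        (fun h hh => (hR h hh).1) fun h hh => (hR h hh).2).trans hYX
    obtain ⟨a, u, i, j, hE, heq⟩ := hH h hh
    obtain ⟨_, _, _, _, _, _, _, _, _, _, _⟩ := id hE
    exact ⟨![a, u, i, j], ⟨hE, heq⟩, by simp [Fin.forall_fin_succ]; omega⟩
  · intro Z hZ hH
    refine ncard_le_of_tuple (n := 8) (fun x h => IsEar B g (x 0) (x 1) (x 1) (x 2) (x 3)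
      (W true · h) (W false · h) ∧ x 1 + x 5 ≤ 2 * g + 1 ∧ IsEar B g (x 4) (x 5) (x 5) (x 6) (x 7)
      (revSeq g (W true · h)) (revSeq g (W false · h)))
      le_rfl (fun h hh => ?_) fun x Z' hZ' hR => ?_
    · obtain ⟨a, u, i, j, hE, a', u', i', j', hu, hE'⟩ := hH h hh
      obtain ⟨_, _, _, _, _, _, _, _, _, _, _⟩ := id hE
      obtain ⟨_, _, _, _, _, _, _, _, _, _, _⟩ := id hE'
      exact ⟨![a, u, i, j, a', u', i', j'], ⟨hE, hu, hE'⟩, by simp [Fin.forall_fin_succ]; omega⟩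
    · rcases Z'.eq_empty_or_nonempty with rfl | ⟨h₀, hh₀⟩
      · simp
      · exact ((hS.mono (hZ'.trans (hZ.trans (hU'.trans (hU.trans hT))))).ncard_le_of_two_ears hc
          (hR h₀ hh₀).2.1 (fun h hh => (hR h hh).1) fun h hh => (hR h hh).2.2).trans hXY
  · intro Z hZ hH
    refine ncard_le_of_tuple (n := 3) (fun x h => IsMiddlePair B g (x 0) (x 1) (x 2)
      (W true · h) (W false · h)) (by omega) (fun h hh => ?_) fun x Z' hZ' hR =>
      ((hS.mono (hZ'.trans (hZ.trans (hU'.trans (hU.trans hT))))).ncard_le_of_middlePair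
        hc hR).trans hXY
    obtain ⟨a, b, i, hE⟩ := hH h hh
    obtain ⟨_, _, _, _, _, _, _, _, _, _⟩ := id hE
    exact ⟨![a, b, i], hE, by simp [Fin.forall_fin_succ]; omega⟩

theorem EncodesMeets.ncard_le (hS : EncodesMeets H π B g W S) (hc : CountingSetup H π B g Δ f)
    (hne : ∀ h ∈ S, ∃ t ≤ 2 * g + 1, W true t h ≠ W false t h) :
    S.ncard ≤ 20 * ((2 * g + 1 + 1) ^ 8 *
      (Fintype.card V * (Δ ^ (2 * g - 1) * (4 * (2 * g + 1 + 1) * f) ^ (2 * g + 1)) +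
        Fintype.card V * (Δ ^ (2 * g) * (4 * (2 * g + 1 + 1) * f) ^ (g + 1)))) := by
  refine (ncard_le_of_or (fun h hh => ?_)
    (fun T hT hH => ncard_le_of_or hH
      (fun U hU => (hS.mono (hU.trans hT)).ncard_le_of_hasShape hc)
      fun U hU => (hS.mono (hU.trans hT)).swap.ncard_le_of_hasShape hc)
    fun T hT hH => ncard_le_of_or hH
      (fun U hU => (hS.mono (hU.trans hT)).rev.ncard_le_of_hasShape hc)
      fun U hU => (hS.mono (hU.trans hT)).swap.rev.ncard_le_of_hasShape hc).trans
    (le_of_eq (by ring))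
  obtain ⟨t, ht, hpt⟩ := hne h hh
  exact (hS.scum h hh true).exists_hasShape hc.block hc.injOn (hS.scum h hh false)
    (hS.zero h hh) (hS.last h hh) ht hpt

end Meets

/-- A vertex sequence indexed by `Fin (n + 1)`, extended to `ℕ` by its last vertex. -/
def extendSeq {V : Type} {n : ℕ} (v : Fin (n + 1) → V) (t : ℕ) : V :=
  v ⟨min t n, by omega⟩

theorem extendSeq_of_le {V : Type} {n t : ℕ} (v : Fin (n + 1) → V) (ht : t ≤ n) :
    extendSeq v t = v ⟨t, by omega⟩ := by
  simp only [extendSeq, Nat.min_eq_left ht]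

theorem seqEdge_extendSeq {V : Type} {n t : ℕ} (v : Fin (n + 1) → V) (ht : t < n) :
    seqEdge (extendSeq v) t = edgeOf v ⟨t, ht⟩ := by
  rw [seqEdge, extendSeq_of_le v (by omega), extendSeq_of_le v (by omega)]
  rfl

theorem IsSCUM.isScumSeq {V : Type} {H : SimpleGraph V} {π : Sym2 V → ℕ}
    {B : Finset (Sym2 (Sym2 V))} {g : ℕ} {v : Fin (2 * g + 1 + 1) → V}
    (hv : IsSCUM H π B (2 * g + 1) v) : IsScumSeq H π B g (extendSeq v) := by
  obtain ⟨hinj, hadj, hmid, hleft, hright⟩ := hv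
  refine ⟨fun i j hi hj h => ?_, fun i hi => ?_, fun i hi => ?_, fun i j hi hj e' he' => ?_,
    fun i j hi hij hj e' he' => ?_⟩
  · rw [extendSeq_of_le v hi, extendSeq_of_le v hj] at h
    simpa using hinj h
  · rw [extendSeq_of_le v (by omega), extendSeq_of_le v (by omega)]
    exact hadj ⟨i, hi⟩
  · rw [seqEdge_extendSeq v hi, seqEdge_extendSeq v (by omega)]
    exact hmid ⟨i, hi⟩ ⟨g, by omega⟩ rfl
  · rw [seqEdge_extendSeq v (by omega)] at he'
    rw [extendSeq_of_le v (by omega)]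
    exact hleft ⟨i, by omega⟩ ⟨j, by omega⟩ (by simp; omega) (by simp; omega) e' he'
  · rw [seqEdge_extendSeq v (by omega)] at he'
    rw [extendSeq_of_le v (by omega)]
    exact hright ⟨i, by omega⟩ ⟨j, by omega⟩ (by simp; omega) hij e' he'

theorem extendSeq_injective {V : Type} {n : ℕ} {v w : Fin (n + 1) → V}
    (h : ∀ t ≤ n, extendSeq v t = extendSeq w t) : v = w := by
  funext i
  have := h i (by omega)
  rwa [extendSeq_of_le v (by omega), extendSeq_of_le w (by omega)] at this

theorem scumMeetCount_le {V : Type} [Fintype V] {H : SimpleGraph V} {π : Sym2 V → ℕ}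
    {B : Finset (Sym2 (Sym2 V))} {g Δ f : ℕ} (hB : IsDoubleBlockingSet H π (2 * g + 1) B)
    (hπ : Set.InjOn π H.edgeSet) (hΔ : ∀ v, (H.neighborSet v).ncard ≤ Δ)
    (hf : ∀ e ∈ H.edgeSet, edgeBlockCount B e ≤ f) :
    scumMeetCount H π B (2 * g + 1) ≤ 20 * ((2 * g + 1 + 1) ^ 8 *
      (Fintype.card V * (Δ ^ (2 * g - 1) * (4 * (2 * g + 1 + 1) * f) ^ (2 * g + 1)) +
        Fintype.card V * (Δ ^ (2 * g) * (4 * (2 * g + 1 + 1) * f) ^ (g + 1)))) := by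
  rw [scumMeetCount]
  set S := {vv : (Fin (2 * g + 1 + 1) → V) × (Fin (2 * g + 1 + 1) → V) |
    IsSCUM H π B (2 * g + 1) vv.1 ∧ IsSCUM H π B (2 * g + 1) vv.2 ∧ vv.1 ≠ vv.2 ∧
    vv.1 0 = vv.2 0 ∧ vv.1 (Fin.last (2 * g + 1)) = vv.2 (Fin.last (2 * g + 1))} with hSdef
  have hS : EncodesMeets H π B g (fun b t vv => extendSeq (bif b then vv.1 else vv.2) t) S :=
    { scum := by
        rintro vv ⟨h1, h2, -⟩ (_ | _)
        exacts [h2.isScumSeq, h1.isScumSeq]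
      sep := fun vv _ ww _ h => Prod.ext (extendSeq_injective fun t ht => h true t ht)
        (extendSeq_injective fun t ht => h false t ht)
      zero := fun vv ⟨_, _, _, h, _⟩ => by
        simp only [cond_true, cond_false]
        rw [extendSeq_of_le _ (by omega), extendSeq_of_le _ (by omega)]
        exact h
      last := fun vv ⟨_, _, _, _, h⟩ => by
        simp only [cond_true, cond_false]
        rw [extendSeq_of_le _ (by omega), extendSeq_of_le _ (by omega)]
        exact h }
  have hne : ∀ vv ∈ S, ∃ t ≤ 2 * g + 1, extendSeq vv.1 t ≠ extendSeq vv.2 t := by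
    rintro vv ⟨-, -, h, -⟩
    by_contra! hcon
    exact h (extendSeq_injective hcon)
  rcases S.eq_empty_or_nonempty with h | ⟨vv, hvv⟩
  · simp [h]
  have hp := hS.scum vv hvv true
  obtain ⟨t, ht, hpt⟩ := hne vv hvv
  obtain ⟨e, e', he⟩ := hp.exists_mem_block hB (hS.scum vv hvv false) (hS.zero vv hvv)
    (hS.last vv hvv) ht hpt
  have hpart := ncard_partners_le hB hf
  exact hS.ncard_le
    { block := hB
      injOn := hπ
      degree := hΔ
      partner := hpart
      one_le_degree := ((Set.ncard_pos (Set.toFinite _)).2 ⟨_, hp.adj 0 (by omega)⟩).trans_le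
        (hΔ _)
      one_le_partner := ((Set.ncard_pos (Set.toFinite _)).2 ⟨e', he⟩).trans_le
        (hpart e) } hne

/-- For every odd positive integer `k` and constant `β > 0` there is a
constant `C > 0` such that: if `H` is a graph on `n` vertices with a linear order on its
edges, average degree `d` and maximum degree at most `β·d`, and `B` is a `2k`
double-blocking set for `H` in which every edge appears in at most `f` pairs, then the
number of SCUM `k`-path meets in `H` is at most
`C·(n·f^k·d^{k−2} + n·f^{(k+1)/2}·d^{k−1})`. -/
theorem statement_12 (k : ℕ) (hk : Odd k) (β : ℝ) (hβ : 0 < β) :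
    ∃ C : ℝ, 0 < C ∧
      ∀ (V : Type) [Fintype V], ∀ (H : SimpleGraph V) (π : Sym2 V → ℕ)
        (B : Finset (Sym2 (Sym2 V))) (f : ℕ),
        Set.InjOn π H.edgeSet →
        (∀ v : V, ((H.neighborSet v).ncard : ℝ) ≤ β * avgDeg H) →
        IsDoubleBlockingSet H π k B →
        (∀ e ∈ H.edgeSet, edgeBlockCount B e ≤ f) →
        (scumMeetCount H π B k : ℝ) ≤
          C * ((Fintype.card V : ℝ) * (f : ℝ) ^ k * avgDeg H ^ (k - 2)
            + (Fintype.card V : ℝ) * (f : ℝ) ^ ((k + 1) / 2) * avgDeg H ^ (k - 1)) := by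
  obtain ⟨g, rfl⟩ := hk
  set A : ℝ := 4 * (2 * g + 1 + 1) with hA
  have hA1 : 1 ≤ A := by rw [hA]; linarith [(Nat.cast_nonneg g : (0 : ℝ) ≤ g)]
  refine ⟨20 * ((2 * g + 1 + 1) ^ 8 * (A ^ (2 * g + 1) * (β ^ (2 * g - 1) + β ^ (2 * g)))),
    by positivity, fun V _ H π B f hπ hdeg hB hf => ?_⟩
  have hd : 0 ≤ avgDeg H := by unfold avgDeg; positivity
  set d := avgDeg H with hd'
  set Δ := ⌊β * d⌋₊ with hΔ
  have hΔd : (Δ : ℝ) ≤ β * d := Nat.floor_le (by positivity)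
  have key : (scumMeetCount H π B (2 * g + 1) : ℝ) ≤ _ :=
    Nat.cast_le.2 (scumMeetCount_le hB hπ (fun v => Nat.le_floor (hdeg v)) hf)
  push_cast at key
  refine key.trans ?_
  rw [← hA, show (2 * g + 1 + 1) / 2 = g + 1 by omega, show 2 * g + 1 - 2 = 2 * g - 1 by omega,
    show 2 * g + 1 - 1 = 2 * g by omega, mul_assoc (20 : ℝ), mul_assoc (_ ^ 8 : ℝ)]
  gcongr
  set n : ℝ := (Fintype.card V : ℝ)
  have hAg : A ^ (g + 1) ≤ A ^ (2 * g + 1) := pow_le_pow_right₀ hA1 (by omega)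
  calc n * ((Δ : ℝ) ^ (2 * g - 1) * (A * f) ^ (2 * g + 1)) +
        n * ((Δ : ℝ) ^ (2 * g) * (A * f) ^ (g + 1))
      ≤ n * ((β * d) ^ (2 * g - 1) * (A * f) ^ (2 * g + 1)) +
        n * ((β * d) ^ (2 * g) * (A * f) ^ (g + 1)) := by gcongr
    _ = A ^ (2 * g + 1) * β ^ (2 * g - 1) * (n * f ^ (2 * g + 1) * d ^ (2 * g - 1)) +
        A ^ (g + 1) * β ^ (2 * g) * (n * f ^ (g + 1) * d ^ (2 * g)) := by
      simp only [mul_pow]; ring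
    _ ≤ A ^ (2 * g + 1) * (β ^ (2 * g - 1) + β ^ (2 * g)) *
          (n * f ^ (2 * g + 1) * d ^ (2 * g - 1)) +
        A ^ (2 * g + 1) * (β ^ (2 * g - 1) + β ^ (2 * g)) *
          (n * f ^ (g + 1) * d ^ (2 * g)) := by
      gcongr
      · exact le_add_of_nonneg_right (by positivity)
      · exact le_add_of_nonneg_left (by positivity)
    _ = _ := by ring
end

section
/- For every odd positive integer k there exist constants C > 0 and γ > 0 (depending only on k) such that the following holds. Let H be a graph on n vertices with a linear order on its edges and a 2k double-blocking set B, let d be its average degree, and suppose every edge of H appears in at most f pairs of B and f ≤ γ·d. If, for some real A ≥ 0, the number of SCUM k-path meets in H is at most A·n^2, then d ≤ C·(n^{1/k} + n^{1/k}·A^{1/(2k)}). -/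
open SimpleGraph
open scoped ENNReal

open Classical in
/-- If every nonempty vertex set contains a vertex of degree at most `t` inside it, then
a vertex set `S` spans at most `t * |S|` edges. -/
theorem ncard_edges_inside_le_of_degenerate {V : Type} [Fintype V] (G : SimpleGraph V) (t : ℝ)
    (h : ∀ S : Finset V, S.Nonempty → ∃ v ∈ S, ((S.filter (G.Adj v)).card : ℝ) ≤ t)
    (S : Finset V) :
    ((G.edgeFinset.filter fun e => ∀ x ∈ e, x ∈ S).card : ℝ) ≤ t * S.card := by
  induction S using Finset.strongInduction with
  | H S ih =>
    rcases S.eq_empty_or_nonempty with rfl | hS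
    · have : (G.edgeFinset.filter fun e => ∀ x ∈ e, x ∈ (∅ : Finset V)) = ∅ := by
        refine Finset.filter_eq_empty_iff.2 fun e _ he => ?_
        induction e with
        | h x y => simpa using he x (by simp)
      rw [this]
      simp
    · obtain ⟨v, hv, hdeg⟩ := h S hS
      have hsub : (G.edgeFinset.filter fun e => ∀ x ∈ e, x ∈ S) ⊆
          (G.edgeFinset.filter fun e => ∀ x ∈ e, x ∈ S.erase v) ∪
            (S.filter (G.Adj v)).image fun u => s(v, u) := by
        intro e he
        induction e with
        | h x y =>
          simp only [Finset.mem_filter, SimpleGraph.mem_edgeFinset, SimpleGraph.mem_edgeSet,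
            Sym2.mem_iff, forall_eq_or_imp, forall_eq, Finset.mem_union, Finset.mem_image,
            Finset.mem_erase] at he ⊢
          obtain ⟨hxy, hx, hy⟩ := he
          by_cases hxv : x = v
          · exact Or.inr ⟨y, ⟨hy, hxv ▸ hxy⟩, by rw [hxv]⟩
          · by_cases hyv : y = v
            · exact Or.inr ⟨x, ⟨hx, hyv ▸ hxy.symm⟩, by rw [hyv, Sym2.eq_swap]⟩
            · exact Or.inl ⟨hxy, ⟨hxv, hx⟩, hyv, hy⟩
      have hcard := (Finset.card_le_card hsub).trans (Finset.card_union_le _ _)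
      have himg : ((S.filter (G.Adj v)).image fun u => s(v, u)).card
          ≤ (S.filter (G.Adj v)).card := Finset.card_image_le
      have hrec := ih (S.erase v) (Finset.erase_ssubset hv)
      have hSc : ((S.erase v).card : ℝ) + 1 = S.card := by
        exact_mod_cast Finset.card_erase_add_one hv
      have hcard' : ((G.edgeFinset.filter fun e => ∀ x ∈ e, x ∈ S).card : ℝ) ≤
          (G.edgeFinset.filter fun e => ∀ x ∈ e, x ∈ S.erase v).card
            + (S.filter (G.Adj v)).card := by
        exact_mod_cast hcard.trans (by gcongr)
      rw [← hSc]
      linarith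

open Classical in
/-- At most `n * d / 4` edges of a graph on `n` vertices fail to be core edges. -/
theorem card_nonCoreEdges_le {V : Type} [Fintype V] (H : SimpleGraph V) (π : Sym2 V → ℕ)
    {d : ℝ} (hd : 0 ≤ d) :
    ((H.edgeFinset.filter fun e => ¬ IsCoreEdge H π d e).card : ℝ) ≤
      d / 4 * Fintype.card V := by
  obtain ⟨N, hNmem⟩ : ∃ N : SimpleGraph V,
      ∀ e, e ∈ N.edgeSet ↔ e ∈ H.edgeSet ∧ ¬ IsCoreEdge H π d e := by
    refine ⟨SimpleGraph.fromEdgeSet {e | e ∈ H.edgeSet ∧ ¬ IsCoreEdge H π d e}, fun e => ?_⟩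
    rw [SimpleGraph.edgeSet_fromEdgeSet]
    exact ⟨fun h => h.1, fun h => ⟨h, H.not_isDiag_of_mem_edgeSet h.1⟩⟩
  have hdegen : ∀ S : Finset V, S.Nonempty →
      ∃ v ∈ S, ((S.filter (N.Adj v)).card : ℝ) ≤ d / 4 := by
    intro S hS
    by_contra! hcon
    have hne : (N.edgeFinset.filter fun e => ∀ x ∈ e, x ∈ S).Nonempty := by
      obtain ⟨v, hv⟩ := hS
      have hpos : 0 < (S.filter (N.Adj v)).card := by
        have := hcon v hv
        have h0 : (0 : ℝ) < (S.filter (N.Adj v)).card := by linarith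
        exact_mod_cast h0
      obtain ⟨u, hu⟩ := Finset.card_pos.1 hpos
      rw [Finset.mem_filter] at hu
      refine ⟨s(v, u), ?_⟩
      simp [hu.1, hu.2, hv]
    obtain ⟨e, he, hmax⟩ := Finset.exists_max_image _ π hne
    rw [Finset.mem_filter, SimpleGraph.mem_edgeFinset, hNmem] at he
    refine he.1.2 ⟨he.1.1, S, fun x hx => he.2 x hx, fun v hv => (hcon v hv).trans_le ?_⟩
    rw [← Set.ncard_coe_finset]
    have hle : (↑(S.filter (N.Adj v)) : Set V) ⊆ {u ∈ (S : Set V) | (subEdges H π e).Adj v u} := by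
      intro u hu
      simp only [Finset.coe_filter, Set.mem_ofPred_eq] at hu
      have hvu : s(v, u) ∈ N.edgeSet := hu.2
      have hπ : π s(v, u) ≤ π e := hmax _ (by simp [hu.1, hu.2]; exact hv)
      refine ⟨hu.1, ?_⟩
      rw [subEdges, SimpleGraph.fromEdgeSet_adj]
      exact ⟨⟨((hNmem _).1 hvu).1, hπ⟩, hu.2.ne⟩
    exact_mod_cast Set.ncard_le_ncard hle (Set.toFinite _)
  have := ncard_edges_inside_le_of_degenerate N (d / 4) hdegen Finset.univ
  rw [Finset.card_univ] at this
  refine le_trans (le_of_eq ?_) this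
  congr 2
  ext e
  simp [hNmem]

/-- The vertices incident on some edge that forms a pair of `B` with `e`. -/
def blockedVerts {V : Type} (B : Finset (Sym2 (Sym2 V))) (e : Sym2 V) : Set V :=
  {y | ∃ e', s(e, e') ∈ B ∧ y ∈ e'}

theorem ncard_blockedVerts_le {V : Type} [Fintype V] {H : SimpleGraph V}
    {B : Finset (Sym2 (Sym2 V))} {f : ℕ} (hB : ∀ b ∈ B, ∀ e ∈ b, e ∈ H.edgeSet)
    (hf : ∀ e ∈ H.edgeSet, edgeBlockCount B e ≤ f) (e : Sym2 V) :
    (blockedVerts B e).ncard ≤ 2 * f := by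
  classical
  set E : Finset (Sym2 V) := Finset.univ.filter fun e' => s(e, e') ∈ B with hE
  have hEf : E.card ≤ f := by
    rcases E.eq_empty_or_nonempty with h0 | ⟨e₀, he₀⟩
    · simp [h0]
    · have he : e ∈ H.edgeSet := hB _ (Finset.mem_filter.1 he₀).2 e (by simp)
      refine le_trans ?_ (hf e he)
      have hinj : Function.Injective fun e' : Sym2 V => s(e, e') := fun x y hxy =>
        Sym2.congr_right.1 hxy
      rw [edgeBlockCount, ← Finset.card_image_of_injective E hinj, ← Set.ncard_coe_finset]
      refine Set.ncard_le_ncard ?_ (B.finite_toSet.subset (Set.sep_subset _ _))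
      intro b hb
      simp only [Finset.coe_image, Set.mem_image, Finset.mem_coe, hE, Finset.mem_filter,
        Finset.mem_univ, true_and] at hb
      obtain ⟨e', he', rfl⟩ := hb
      exact ⟨he', by simp⟩
  have hsub : blockedVerts B e ⊆ ↑(E.biUnion Sym2.toFinset) := by
    rintro y ⟨e', he', hy⟩
    simp only [Finset.coe_biUnion, Set.mem_iUnion]
    exact ⟨e', by simpa [hE] using he', by simpa using hy⟩
  refine (Set.ncard_le_ncard hsub (Finset.finite_toSet _)).trans ?_
  rw [Set.ncard_coe_finset, mul_comm]
  refine (Finset.card_biUnion_le_card_mul E _ 2 fun e' _ => ?_).trans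
    (Nat.mul_le_mul_right 2 hEf)
  rw [Sym2.card_toFinset]
  split_ifs <;> simp

/-- The vertex sequence `v` restricted to the window `[lo, hi]` is a simple path of `G` within
`S`, with middle edge `(v m, v (m + 1)) = (a, b)`, whose two subpaths leaving the middle edge are
chain-unblocked. Outside the window `v` is constantly `a`. -/
structure IsPartialPath {V : Type} (G : SimpleGraph V) (S : Set V) (B : Finset (Sym2 (Sym2 V)))
    (m : ℕ) (a b : V) (lo hi : ℕ) (v : ℕ → V) : Prop where
  mid_left : v m = a
  mid_right : v (m + 1) = b
  off : ∀ j, j < lo ∨ hi < j → v j = a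
  mem : ∀ j, lo ≤ j → j ≤ hi → v j ∈ S
  inj : ∀ i j, lo ≤ i → i < j → j ≤ hi → v i ≠ v j
  adj : ∀ i, lo ≤ i → i + 1 ≤ hi → G.Adj (v i) (v (i + 1))
  left : ∀ i j, i ≤ m → lo ≤ j → j < i → v j ∉ blockedVerts B s(v i, v (i + 1))
  right : ∀ i j, m ≤ i → i + 2 ≤ j → j ≤ hi → v j ∉ blockedVerts B s(v i, v (i + 1))

section Extension

variable {V : Type} {G : SimpleGraph V} {S : Set V} {B : Finset (Sym2 (Sym2 V))}
  {m : ℕ} {a b : V} {lo hi : ℕ} {v : ℕ → V} {y : V}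

theorem IsPartialPath.extend_right (hv : IsPartialPath G S B m a b lo hi v)
    (hlo : lo ≤ m) (hhi : m + 1 ≤ hi) (hy : y ∈ S) (hadj : G.Adj (v hi) y)
    (hinj : ∀ i, lo ≤ i → i ≤ hi → y ≠ v i)
    (hblock : ∀ i, lo ≤ i → i < hi → y ∉ blockedVerts B s(v i, v (i + 1))) :
    IsPartialPath G S B m a b lo (hi + 1) (Function.update v (hi + 1) y) := by
  have hne : ∀ j, j ≠ hi + 1 → Function.update v (hi + 1) y j = v j :=
    fun j hj => Function.update_of_ne hj _ _
  have heq : Function.update v (hi + 1) y (hi + 1) = y := Function.update_self _ _ _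
  refine ⟨?_, ?_, ?_, ?_, ?_, ?_, ?_, ?_⟩
  · rw [hne _ (by omega), hv.mid_left]
  · rw [hne _ (by omega), hv.mid_right]
  · intro j hj
    rw [hne _ (by omega), hv.off j (by omega)]
  · intro j hj hj'
    rcases eq_or_ne j (hi + 1) with rfl | h
    · rwa [heq]
    · rw [hne _ h]
      exact hv.mem j hj (by omega)
  · intro i j hi' hij hj
    rw [hne i (by omega)]
    rcases eq_or_ne j (hi + 1) with rfl | h
    · rw [heq]
      exact (hinj i hi' (by omega)).symm
    · rw [hne _ h]
      exact hv.inj i j hi' hij (by omega)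
  · intro i hi' hi''
    rw [hne i (by omega)]
    rcases eq_or_ne i hi with rfl | h
    · rwa [heq]
    · rw [hne _ (by omega)]
      exact hv.adj i hi' (by omega)
  · intro i j hi' hj hji
    rw [hne i (by omega), hne j (by omega), hne (i + 1) (by omega)]
    exact hv.left i j hi' hj hji
  · intro i j hi' hij hj
    rw [hne i (by omega), hne (i + 1) (by omega)]
    rcases eq_or_ne j (hi + 1) with rfl | h
    · rw [heq]
      exact hblock i (by omega) (by omega)
    · rw [hne _ h]
      exact hv.right i j hi' hij (by omega)

theorem IsPartialPath.extend_left (hv : IsPartialPath G S B m a b (lo + 1) hi v)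
    (hlo : lo + 1 ≤ m) (hhi : m + 1 ≤ hi) (hy : y ∈ S) (hadj : G.Adj (v (lo + 1)) y)
    (hinj : ∀ i, lo + 1 ≤ i → i ≤ hi → y ≠ v i)
    (hblock : ∀ i, lo + 1 ≤ i → i < hi → y ∉ blockedVerts B s(v i, v (i + 1))) :
    IsPartialPath G S B m a b lo hi (Function.update v lo y) := by
  have hne : ∀ j, j ≠ lo → Function.update v lo y j = v j :=
    fun j hj => Function.update_of_ne hj _ _
  have heq : Function.update v lo y lo = y := Function.update_self _ _ _
  refine ⟨?_, ?_, ?_, ?_, ?_, ?_, ?_, ?_⟩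
  · rw [hne _ (by omega), hv.mid_left]
  · rw [hne _ (by omega), hv.mid_right]
  · intro j hj
    rw [hne _ (by omega), hv.off j (by omega)]
  · intro j hj hj'
    rcases eq_or_ne j lo with rfl | h
    · rwa [heq]
    · rw [hne _ h]
      exact hv.mem j (by omega) hj'
  · intro i j hi' hij hj
    rw [hne j (by omega)]
    rcases eq_or_ne i lo with rfl | h
    · rw [heq]
      exact hinj j (by omega) hj
    · rw [hne _ h]
      exact hv.inj i j (by omega) hij hj
  · intro i hi' hi''
    rw [hne (i + 1) (by omega)]
    rcases eq_or_ne i lo with rfl | h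
    · rw [heq]
      exact hadj.symm
    · rw [hne _ h]
      exact hv.adj i (by omega) hi''
  · intro i j hi' hj hji
    rw [hne i (by omega), hne (i + 1) (by omega)]
    rcases eq_or_ne j lo with rfl | h
    · rw [heq]
      exact hblock i (by omega) (by omega)
    · rw [hne _ h]
      exact hv.left i j hi' (by omega) hji
  · intro i j hi' hij hj
    rw [hne i (by omega), hne j (by omega), hne (i + 1) (by omega)]
    exact hv.right i j hi' hij hj

/-- If all functions in `T` take the same value at `s`, and each can be reassigned at `s` in at
least `D` ways, then there are at least `D * |T|` reassigned functions. -/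
theorem exists_finset_update {ι W : Type} [DecidableEq ι] {s : ι} {a : W} {T : Finset (ι → W)}
    (hT : ∀ v ∈ T, v s = a) (Y : (ι → W) → Finset W) {D : ℝ}
    (hY : ∀ v ∈ T, D ≤ (Y v).card) :
    ∃ T' : Finset (ι → W), D * T.card ≤ T'.card ∧
      ∀ w ∈ T', ∃ v ∈ T, ∃ y ∈ Y v, w = Function.update v s y := by
  classical
  refine ⟨(T.sigma Y).image fun p => Function.update p.1 s p.2, ?_, ?_⟩
  · rw [Finset.card_image_of_injOn, Finset.card_sigma]
    · push_cast
      calc D * (T.card : ℝ) = ∑ _v ∈ T, D := by simp [mul_comm]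
        _ ≤ _ := Finset.sum_le_sum hY
    · rintro ⟨v, y⟩ hv ⟨w, z⟩ hw h
      simp only [Finset.coe_sigma, Set.mem_sigma_iff, Finset.mem_coe] at hv hw
      simp only at h
      have hyz : y = z := by simpa using congrFun h s
      have hvw : v = w := by
        have := congrArg (fun u => Function.update u s a) h
        simp only [Function.update_idem] at this
        rwa [← hT v hv.1, Function.update_eq_self, hT v hv.1, ← hT w hw.1,
          Function.update_eq_self] at this
      subst hyz hvw
      rfl
  · intro w hw
    rw [Finset.mem_image] at hw
    obtain ⟨⟨v, y⟩, hvy, rfl⟩ := hw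
    rw [Finset.mem_sigma] at hvy
    exact ⟨v, hvy.1, y, hvy.2, rfl⟩

/-- Vertices that must be avoided when extending the vertex sequence `v`. -/
def forbiddenVerts (B : Finset (Sym2 (Sym2 V))) (k : ℕ) (v : ℕ → V) : Set V :=
  v '' (Finset.range (k + 1)) ∪ ⋃ i ∈ Finset.range k, blockedVerts B s(v i, v (i + 1))

theorem ncard_forbiddenVerts_le {f k : ℕ} (hf : ∀ e, (blockedVerts B e).ncard ≤ 2 * f)
    (v : ℕ → V) : (forbiddenVerts B k v).ncard ≤ (k + 1) + k * (2 * f) := by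
  classical
  refine (Set.ncard_union_le _ _).trans (add_le_add ?_ ?_)
  · refine (Set.ncard_image_le (Finset.finite_toSet _)).trans ?_
    rw [Set.ncard_coe_finset, Finset.card_range]
  · refine (Finset.set_ncard_biUnion_le _ _).trans ?_
    calc _ ≤ ∑ _i ∈ Finset.range k, 2 * f := Finset.sum_le_sum fun i _ => hf _
      _ = _ := by simp

theorem ne_of_notMem_forbiddenVerts {k : ℕ} (hy : y ∉ forbiddenVerts B k v) {i : ℕ}
    (hi : i ≤ k) : y ≠ v i := by
  rintro rfl
  exact hy (Or.inl ⟨i, by simpa [Nat.lt_succ_iff] using hi, rfl⟩)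

theorem notMem_blockedVerts_of_notMem_forbiddenVerts {k : ℕ} (hy : y ∉ forbiddenVerts B k v)
    {i : ℕ} (hi : i < k) : y ∉ blockedVerts B s(v i, v (i + 1)) := fun h =>
  hy (Or.inr (Set.mem_biUnion (by simpa using hi) h))

variable [Fintype V]

open Classical in
/-- The admissible new neighbours of `x` when extending the vertex sequence `v`. -/
noncomputable def extensionVerts (G : SimpleGraph V) (S : Set V) (B : Finset (Sym2 (Sym2 V))) (k : ℕ)
    (v : ℕ → V) (x : V) : Finset V :=
  Finset.univ.filter fun y => y ∈ {u ∈ S | G.Adj x u} \ forbiddenVerts B k v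

theorem mem_extensionVerts {k : ℕ} {x : V} :
    y ∈ extensionVerts G S B k v x ↔ (y ∈ S ∧ G.Adj x y) ∧ y ∉ forbiddenVerts B k v := by
  simp [extensionVerts]

theorem le_card_extensionVerts {f k : ℕ} {δ : ℝ} (hf : ∀ e, (blockedVerts B e).ncard ≤ 2 * f)
    (hS : ∀ x ∈ S, δ < ({u ∈ S | G.Adj x u}.ncard : ℝ)) {x : V} (hx : x ∈ S) :
    δ - ((k + 1) + k * (2 * f)) ≤ (extensionVerts G S B k v x).card := by
  classical
  have h1 := hS x hx
  have h2 : ((forbiddenVerts B k v).ncard : ℝ) ≤ (k + 1) + k * (2 * f) := by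
    exact_mod_cast ncard_forbiddenVerts_le hf v
  have h3 : ({u ∈ S | G.Adj x u}.ncard : ℝ) ≤
      (extensionVerts G S B k v x).card + (forbiddenVerts B k v).ncard := by
    rw [← Set.ncard_coe_finset]
    have : (↑(extensionVerts G S B k v x) : Set V) =
        {u ∈ S | G.Adj x u} \ forbiddenVerts B k v := by
      ext y
      simp [extensionVerts]
    rw [this]
    exact_mod_cast Set.ncard_le_ncard_sdiff_add_ncard _ _ (Set.toFinite _)
  linarith

/-- An edge inside a set of large minimum degree is the middle edge of many unblocked paths. -/
theorem exists_many_partialPaths {f : ℕ} {δ D : ℝ}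
    (hf : ∀ e, (blockedVerts B e).ncard ≤ 2 * f)
    (hS : ∀ x ∈ S, δ < ({u ∈ S | G.Adj x u}.ncard : ℝ)) (hD : 0 ≤ D)
    (hDδ : D ≤ δ - (((2 * m + 1 : ℕ) + 1) + (2 * m + 1 : ℕ) * (2 * f)))
    (ha : a ∈ S) (hb : b ∈ S) (hab : G.Adj a b) :
    ∃ T : Finset (ℕ → V), D ^ (2 * m) ≤ T.card ∧
      ∀ v ∈ T, IsPartialPath G S B m a b 0 (2 * m + 1) v := by
  classical
  have hright : ∀ t ≤ m, ∃ T : Finset (ℕ → V), D ^ t ≤ T.card ∧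
      ∀ v ∈ T, IsPartialPath G S B m a b m (m + 1 + t) v := by
    intro t
    induction t with
    | zero =>
      intro _
      refine ⟨{Function.update (fun _ => a) (m + 1) b}, by simp, fun v hv => ?_⟩
      rw [Finset.mem_singleton] at hv
      have hvm : v (m + 1) = b := by simp [hv]
      have hva : ∀ j, j ≠ m + 1 → v j = a := fun j hj => by
        rw [hv, Function.update_of_ne hj]
      refine ⟨hva _ (by omega), hvm, fun j hj => hva _ (by omega), ?_, ?_, ?_, ?_, ?_⟩
      · intro j _ _
        by_cases h : j = m + 1
        · rwa [h, hvm]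
        · rwa [hva j h]
      · intro i j _ _ _
        rw [show j = m + 1 by omega, hvm, hva i (by omega)]
        exact hab.ne
      · intro i _ _
        rw [show i = m by omega, hvm, hva m (by omega)]
        exact hab
      · intros
        omega
      · intros
        omega
    | succ t ih =>
      intro ht
      obtain ⟨T, hT, hTv⟩ := ih (by omega)
      obtain ⟨T', hT', hTv'⟩ := exists_finset_update (s := m + 1 + t + 1) (a := a) (T := T)
        (fun v hv => (hTv v hv).off _ (by omega))
        (fun v => extensionVerts G S B (2 * m + 1) v (v (m + 1 + t))) (D := D)
        (fun v hv => hDδ.trans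
          (le_card_extensionVerts hf hS ((hTv v hv).mem _ (by omega) le_rfl)))
      refine ⟨T', le_trans ?_ hT', fun w hw => ?_⟩
      · rw [pow_succ']
        gcongr
      · obtain ⟨v, hv, y, hy, rfl⟩ := hTv' w hw
        rw [mem_extensionVerts] at hy
        exact (hTv v hv).extend_right le_rfl (by omega) hy.1.1 hy.1.2
          (fun i _ _ => ne_of_notMem_forbiddenVerts hy.2 (by omega))
          (fun i _ _ => notMem_blockedVerts_of_notMem_forbiddenVerts hy.2 (by omega))
  have hleft : ∀ t lo, lo + t = m → ∃ T : Finset (ℕ → V), D ^ (m + t) ≤ T.card ∧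
      ∀ v ∈ T, IsPartialPath G S B m a b lo (2 * m + 1) v := by
    intro t
    induction t with
    | zero =>
      rintro lo rfl
      obtain ⟨T, hT, hTv⟩ := hright (lo + 0) le_rfl
      exact ⟨T, hT, fun v hv => by
        have := hTv v hv
        rwa [show lo + 0 + 1 + (lo + 0) = 2 * (lo + 0) + 1 by omega] at this⟩
    | succ t ih =>
      intro lo hlo
      obtain ⟨T, hT, hTv⟩ := ih (lo + 1) (by omega)
      obtain ⟨T', hT', hTv'⟩ := exists_finset_update (s := lo) (a := a) (T := T)
        (fun v hv => (hTv v hv).off _ (by omega))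
        (fun v => extensionVerts G S B (2 * m + 1) v (v (lo + 1))) (D := D)
        (fun v hv => hDδ.trans
          (le_card_extensionVerts hf hS ((hTv v hv).mem _ le_rfl (by omega))))
      refine ⟨T', le_trans ?_ hT', fun w hw => ?_⟩
      · rw [← add_assoc, pow_succ']
        gcongr
      · obtain ⟨v, hv, y, hy, rfl⟩ := hTv' w hw
        rw [mem_extensionVerts] at hy
        exact (hTv v hv).extend_left (by omega) (by omega) hy.1.1 hy.1.2
          (fun i _ _ => ne_of_notMem_forbiddenVerts hy.2 (by omega))
          (fun i _ _ => notMem_blockedVerts_of_notMem_forbiddenVerts hy.2 (by omega))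
  obtain ⟨T, hT, hTv⟩ := hleft m 0 (by omega)
  exact ⟨T, by rwa [two_mul], hTv⟩

end Extension

theorem IsPartialPath.isSCUM {V : Type} {H : SimpleGraph V} {π : Sym2 V → ℕ} {S : Set V}
    {B : Finset (Sym2 (Sym2 V))} {m : ℕ} {a b : V} {v : ℕ → V}
    (hv : IsPartialPath (subEdges H π s(a, b)) S B m a b 0 (2 * m + 1) v) :
    IsSCUM H π B (2 * m + 1) (fun i => v i) := by
  have hadj : ∀ i < 2 * m + 1, s(v i, v (i + 1)) ∈ H.edgeSet ∧
      π s(v i, v (i + 1)) ≤ π s(a, b) := fun i hi => by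
    have := hv.adj i (by omega) (by omega)
    rw [subEdges, SimpleGraph.fromEdgeSet_adj] at this
    exact this.1
  refine ⟨?_, fun i => (hadj i i.2).1, ?_, ?_, ?_⟩
  · intro i j hij
    by_contra hne
    rcases lt_or_gt_of_ne (fun h => hne (Fin.ext h) : (i : ℕ) ≠ j) with h | h
    · exact hv.inj i j (by omega) h (by omega) hij
    · exact hv.inj j i (by omega) h (by omega) hij.symm
  · intro i j hj
    have hjm : (j : ℕ) = m := by omega
    have : edgeOf (fun i : Fin (2 * m + 1 + 1) => v i) j = s(a, b) := by
      simp [edgeOf, hjm, hv.mid_left, hv.mid_right]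
    rw [this]
    exact (hadj i i.2).2
  · intro i j hi hj e' he' hmem
    exact hv.left i j (by omega) (by omega) (by omega) ⟨e', he', hmem⟩
  · intro i j hi hj e' he' hmem
    exact hv.right i j (by omega) (by omega) (by omega) ⟨e', he', hmem⟩

open Classical in
/-- A lower bound on the number of SCUM paths in terms of the number of core edges. -/
theorem coreEdges_mul_pow_le_scumCount {V : Type} [Fintype V] {H : SimpleGraph V}
    {π : Sym2 V → ℕ} {B : Finset (Sym2 (Sym2 V))} {f m : ℕ} {d D : ℝ}
    (hf : ∀ e, (blockedVerts B e).ncard ≤ 2 * f) (hD : 0 ≤ D)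
    (hDd : D ≤ d / 4 - (((2 * m + 1 : ℕ) + 1) + (2 * m + 1 : ℕ) * (2 * f))) :
    ((H.edgeFinset.filter (IsCoreEdge H π d)).card : ℝ) * D ^ (2 * m) ≤
      scumCount H π B (2 * m + 1) := by
  have key : ∀ e : Sym2 V, ∃ T : Finset (Fin (2 * m + 1 + 1) → V), IsCoreEdge H π d e →
      D ^ (2 * m) ≤ T.card ∧ ∀ v ∈ T, IsSCUM H π B (2 * m + 1) v ∧
        edgeOf v ⟨m, by omega⟩ = e := by
    intro e
    by_cases he : IsCoreEdge H π d e
    swap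
    · exact ⟨∅, fun h => absurd h he⟩
    induction e with
    | h a b =>
      obtain ⟨heH, S, hSe, hS⟩ := he
      have hab : (subEdges H π s(a, b)).Adj a b := by
        rw [subEdges, SimpleGraph.fromEdgeSet_adj]
        exact ⟨⟨heH, le_rfl⟩, H.ne_of_adj heH⟩
      obtain ⟨T, hT, hTv⟩ := exists_many_partialPaths hf hS hD hDd (hSe a (by simp))
        (hSe b (by simp)) hab
      refine ⟨T.image fun v i => v i, fun _ => ⟨?_, ?_⟩⟩
      · rwa [Finset.card_image_of_injOn]
        intro v hv w hw hvw
        funext j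
        by_cases hj : j < 2 * m + 1 + 1
        · exact congrFun hvw ⟨j, hj⟩
        · rw [(hTv v hv).off j (by omega), (hTv w hw).off j (by omega)]
      · intro w hw
        obtain ⟨v, hv, rfl⟩ := Finset.mem_image.1 hw
        refine ⟨(hTv v hv).isSCUM, ?_⟩
        simp [edgeOf, (hTv v hv).mid_left, (hTv v hv).mid_right]
  choose T hT using key
  set K := H.edgeFinset.filter (IsCoreEdge H π d) with hK
  have hcore : ∀ e ∈ K, IsCoreEdge H π d e := fun e he => (Finset.mem_filter.1 he).2
  have hdisj : (K : Set (Sym2 V)).PairwiseDisjoint T := by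
    intro e he e' he' hne
    refine Finset.disjoint_left.2 fun v hv hv' => hne ?_
    rw [← ((hT e (hcore e he)).2 v hv).2, ((hT e' (hcore e' he')).2 v hv').2]
  have hle : (K.biUnion T).card ≤ scumCount H π B (2 * m + 1) := by
    rw [scumCount, ← Set.ncard_coe_finset]
    refine Set.ncard_le_ncard (fun v hv => ?_) (Set.toFinite _)
    simp only [Finset.coe_biUnion, Set.mem_iUnion] at hv
    obtain ⟨e, he, hv⟩ := hv
    exact ((hT e (hcore e he)).2 v hv).1
  calc (K.card : ℝ) * D ^ (2 * m) = ∑ _e ∈ K, D ^ (2 * m) := by simp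
    _ ≤ ∑ e ∈ K, ((T e).card : ℝ) := Finset.sum_le_sum fun e he => (hT e (hcore e he)).1
    _ = ((K.biUnion T).card : ℝ) := by rw [Finset.card_biUnion hdisj]; push_cast; rfl
    _ ≤ _ := by exact_mod_cast hle

/-- Cauchy–Schwarz for collisions: a map from `P` to a set of size `N` has at least
`|P| ^ 2 / N - |P|` ordered pairs of distinct colliding elements. -/
theorem sq_card_le_card_mul_collisions {α β : Type} [Fintype β] [DecidableEq α] [DecidableEq β]
    (P : Finset α) (φ : α → β) :
    P.card ^ 2 ≤ Fintype.card β *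
      (((P ×ˢ P).filter fun q => q.1 ≠ q.2 ∧ φ q.1 = φ q.2).card + P.card) := by
  have h1 : P.card = ∑ z : β, (P.filter fun p => φ p = z).card :=
    Finset.card_eq_sum_card_fiberwise fun p _ => Finset.mem_coe.2 (Finset.mem_univ _)
  have h2 : ((P ×ˢ P).filter fun q => φ q.1 = φ q.2).card =
      ∑ z : β, (P.filter fun p => φ p = z).card ^ 2 := by
    rw [Finset.card_eq_sum_card_fiberwise (f := fun q : α × α => φ q.1) (t := Finset.univ)
      fun p _ => Finset.mem_coe.2 (Finset.mem_univ _)]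
    refine Finset.sum_congr rfl fun z _ => ?_
    rw [sq, ← Finset.card_product]
    congr 1
    ext ⟨p, q⟩
    simp only [Finset.mem_filter, Finset.mem_product]
    constructor
    · rintro ⟨⟨⟨hp, hq⟩, h⟩, rfl⟩
      exact ⟨⟨hp, rfl⟩, hq, h.symm⟩
    · rintro ⟨⟨hp, rfl⟩, hq, h⟩
      exact ⟨⟨⟨hp, hq⟩, h.symm⟩, rfl⟩
  have h3 : ((P ×ˢ P).filter fun q => φ q.1 = φ q.2).card ≤
      ((P ×ˢ P).filter fun q => q.1 ≠ q.2 ∧ φ q.1 = φ q.2).card + P.card := by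
    have hsub : ((P ×ˢ P).filter fun q => φ q.1 = φ q.2) ⊆
        ((P ×ˢ P).filter fun q => q.1 ≠ q.2 ∧ φ q.1 = φ q.2) ∪ P.diag := by
      rintro ⟨p, q⟩ h
      simp only [Finset.mem_filter, Finset.mem_product, Finset.mem_union,
        Finset.mem_diag] at h ⊢
      tauto
    have := (Finset.card_le_card hsub).trans (Finset.card_union_le _ _)
    rwa [Finset.diag_card] at this
  calc P.card ^ 2 = (∑ z : β, (P.filter fun p => φ p = z).card) ^ 2 := by rw [← h1]
    _ ≤ Fintype.card β * ∑ z : β, (P.filter fun p => φ p = z).card ^ 2 :=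
      sq_sum_le_card_mul_sum_sq
    _ ≤ _ := by
      rw [← h2]
      exact Nat.mul_le_mul_left _ h3

theorem sq_scumCount_le {V : Type} [Fintype V] (H : SimpleGraph V) (π : Sym2 V → ℕ)
    (B : Finset (Sym2 (Sym2 V))) (k : ℕ) :
    scumCount H π B k ^ 2 ≤
      Fintype.card V ^ 2 * (scumMeetCount H π B k + scumCount H π B k) := by
  classical
  have hP : scumCount H π B k = (Finset.univ.filter (IsSCUM H π B k)).card := by
    rw [scumCount, ← Set.ncard_coe_finset]
    simp
  have hM : scumMeetCount H π B k =
      (((Finset.univ.filter (IsSCUM H π B k)) ×ˢ (Finset.univ.filter (IsSCUM H π B k))).filter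
        fun q => q.1 ≠ q.2 ∧ (q.1 0, q.1 (Fin.last k)) = (q.2 0, q.2 (Fin.last k))).card := by
    rw [scumMeetCount, ← Set.ncard_coe_finset]
    congr 1
    ext q
    simp [and_assoc]
  have := sq_card_le_card_mul_collisions (Finset.univ.filter (IsSCUM H π B k))
    fun v => (v 0, v (Fin.last k))
  rwa [← hM, ← hP, Fintype.card_prod, ← sq] at this

/-- The final numerical estimate: many paths and few meets bound the degree parameter `x`. -/
theorem le_of_pow_le_of_sq_le {k : ℕ} (hk : k ≠ 0) {n x P M A : ℝ} (hn : 1 ≤ n) (hx : 0 ≤ x)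
    (hA : 0 ≤ A) (hP : n * x ^ k ≤ P) (hPM : P ^ 2 ≤ n ^ 2 * (M + P)) (hM : M ≤ A * n ^ 2) :
    x ≤ 2 * (n ^ (1 / (k : ℝ)) + n ^ (1 / (k : ℝ)) * A ^ (1 / (2 * (k : ℝ)))) := by
  have hn0 : 0 < n := by linarith
  have hnk : (n ^ (1 / (k : ℝ))) ^ k = n := by
    rw [one_div, Real.rpow_inv_natCast_pow hn0.le hk]
  have hAk : (A ^ (1 / (2 * (k : ℝ)))) ^ (2 * k) = A := by
    have := Real.rpow_inv_natCast_pow hA (n := 2 * k) (by omega)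
    rwa [Nat.cast_mul, Nat.cast_ofNat, ← one_div] at this
  have hr : 0 ≤ n ^ (1 / (k : ℝ)) := by positivity
  have hs : 0 ≤ A ^ (1 / (2 * (k : ℝ))) := by positivity
  set r := n ^ (1 / (k : ℝ))
  set s := A ^ (1 / (2 * (k : ℝ)))
  have hxk : 0 ≤ n * x ^ k := by positivity
  have two_le : ∀ j : ℕ, j ≠ 0 → (2 : ℝ) ≤ 2 ^ j := fun j hj =>
    le_self_pow₀ (by norm_num) hj
  rcases le_or_gt P (2 * n ^ 2) with hcase | hcase
  · have h1 : x ^ k ≤ 2 * n := by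
      refine le_of_mul_le_mul_left ?_ hn0
      linarith
    have h2 : x ≤ 2 * r := by
      refine le_of_pow_le_pow_left₀ hk (by positivity) ?_
      rw [mul_pow, hnk]
      exact h1.trans (mul_le_mul_of_nonneg_right (two_le k hk) hn0.le)
    have : 0 ≤ r * s := by positivity
    linarith
  · have h1 : P ^ 2 ≤ 2 * A * n ^ 4 := by
      have hP0 : 0 ≤ P := hxk.trans hP
      nlinarith [mul_le_mul_of_nonneg_left hM (sq_nonneg n),
        mul_le_mul_of_nonneg_left hcase.le hP0]
    have h2 : (n * x ^ k) ^ 2 ≤ P ^ 2 := pow_le_pow_left₀ hxk hP 2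
    have h3 : x ^ (2 * k) ≤ 2 * (A * n ^ 2) := by
      refine le_of_mul_le_mul_left ?_ (pow_pos hn0 2)
      calc n ^ 2 * x ^ (2 * k) = (n * x ^ k) ^ 2 := by rw [mul_pow, ← pow_mul, mul_comm k 2]
        _ ≤ 2 * A * n ^ 4 := h2.trans h1
        _ = n ^ 2 * (2 * (A * n ^ 2)) := by ring
    have h4 : x ≤ 2 * (r * s) := by
      refine le_of_pow_le_pow_left₀ (n := 2 * k) (by omega) (by positivity) ?_
      rw [mul_pow, mul_pow, hAk, mul_comm 2 k, pow_mul r, hnk, mul_comm k 2, mul_comm (n ^ 2)]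
      exact h3.trans (mul_le_mul_of_nonneg_right (two_le _ (by omega)) (by positivity))
    linarith

theorem mul_pow_le_scumCount {V : Type} [Fintype V] [Nonempty V] {H : SimpleGraph V}
    {π : Sym2 V → ℕ} {B : Finset (Sym2 (Sym2 V))} {f m : ℕ}
    (hf : ∀ e, (blockedVerts B e).ncard ≤ 2 * f)
    (hfd : (f : ℝ) ≤ 1 / (16 * (2 * m + 1)) * avgDeg H)
    (hd : 16 * (2 * m + 2) ≤ avgDeg H) :
    (Fintype.card V : ℝ) * (avgDeg H / 16) ^ (2 * m + 1) ≤ scumCount H π B (2 * m + 1) := by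
  classical
  have hn : (0 : ℝ) < Fintype.card V := by exact_mod_cast Fintype.card_pos
  set d := avgDeg H with hdef
  have hd0 : 0 ≤ d := le_trans (by positivity) hd
  have hE : (H.edgeFinset.card : ℝ) = Fintype.card V * d / 2 := by
    rw [hdef, avgDeg, ← SimpleGraph.coe_edgeFinset, Set.ncard_coe_finset]
    field_simp
  have hsplit : ((H.edgeFinset.filter (IsCoreEdge H π d)).card : ℝ) +
      (H.edgeFinset.filter fun e => ¬ IsCoreEdge H π d e).card = H.edgeFinset.card := by
    exact_mod_cast Finset.card_filter_add_card_filter_not (s := H.edgeFinset) _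
  have hnon := card_nonCoreEdges_le H π hd0
  have hcore : Fintype.card V * (d / 16) ≤
      ((H.edgeFinset.filter (IsCoreEdge H π d)).card : ℝ) := by
    have : 0 ≤ Fintype.card V * d := by positivity
    linarith
  have hfm : (2 * m + 1 : ℝ) * (2 * f) ≤ d / 8 := by
    have hm : (0 : ℝ) < 2 * m + 1 := by positivity
    calc (2 * m + 1 : ℝ) * (2 * f) ≤ (2 * m + 1) * (2 * (1 / (16 * (2 * m + 1)) * d)) := by gcongr
      _ = d / 8 := by field_simp; ring
  have := coreEdges_mul_pow_le_scumCount (H := H) (π := π) (m := m) (d := d) (D := d / 16) hf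
    (by positivity) (by push_cast; linarith)
  refine le_trans ?_ this
  rw [pow_succ', ← mul_assoc]
  gcongr

/-- For every odd positive integer `k` there exist constants `C, γ > 0`
such that: if `H` is a graph on `n` vertices with a linear order on its edges and a `2k`
double-blocking set `B`, `d` is its average degree, every edge of `H` appears in at most
`f` pairs of `B`, `f ≤ γ·d`, and for some real `A ≥ 0` the number of SCUM `k`-path meets
in `H` is at most `A·n^2`, then `d ≤ C·(n^{1/k} + n^{1/k}·A^{1/(2k)})`. -/
theorem statement_13 (k : ℕ) (hk : Odd k) :
    ∃ C γ : ℝ, 0 < C ∧ 0 < γ ∧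
      ∀ (V : Type) [Fintype V], ∀ (H : SimpleGraph V) (π : Sym2 V → ℕ)
        (B : Finset (Sym2 (Sym2 V))) (f : ℕ) (A : ℝ),
        0 ≤ A →
        Set.InjOn π H.edgeSet →
        IsDoubleBlockingSet H π k B →
        (∀ e ∈ H.edgeSet, edgeBlockCount B e ≤ f) →
        (f : ℝ) ≤ γ * avgDeg H →
        (scumMeetCount H π B k : ℝ) ≤ A * (Fintype.card V : ℝ) ^ 2 →
        avgDeg H ≤
          C * ((Fintype.card V : ℝ) ^ (1 / (k : ℝ))
            + (Fintype.card V : ℝ) ^ (1 / (k : ℝ)) * A ^ (1 / (2 * (k : ℝ)))) := by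
  obtain ⟨m, rfl⟩ := hk
  refine ⟨32 * (2 * m + 2), 1 / (16 * (2 * m + 1)), by positivity, by positivity, ?_⟩
  intro V _ H π B f A hA _ hB hf hfd hM
  rcases isEmpty_or_nonempty V with hV | hV
  · have : avgDeg H = 0 := by simp [avgDeg]
    rw [this]
    positivity
  have hn : (1 : ℝ) ≤ Fintype.card V := by exact_mod_cast Fintype.card_pos
  have hr : 1 ≤ (Fintype.card V : ℝ) ^ (1 / ((2 * m + 1 : ℕ) : ℝ)) :=
    Real.one_le_rpow hn (by positivity)
  have hrs : 0 ≤ (Fintype.card V : ℝ) ^ (1 / ((2 * m + 1 : ℕ) : ℝ)) *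
      A ^ (1 / (2 * ((2 * m + 1 : ℕ) : ℝ))) := by positivity
  have hm : (0 : ℝ) ≤ m := by positivity
  rcases lt_or_ge (avgDeg H) (16 * (2 * m + 2)) with hd | hd
  · nlinarith
  · have hblock := ncard_blockedVerts_le (fun b hb => (hB.1 b hb).2) hf
    have hP := mul_pow_le_scumCount (π := π) hblock hfd hd
    have hPM : (scumCount H π B (2 * m + 1) : ℝ) ^ 2 ≤ (Fintype.card V : ℝ) ^ 2 *
        (scumMeetCount H π B (2 * m + 1) + scumCount H π B (2 * m + 1)) := by
      exact_mod_cast sq_scumCount_le H π B (2 * m + 1)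
    have hd0 : 0 ≤ avgDeg H := le_trans (by positivity) hd
    have := le_of_pow_le_of_sq_le (by omega) hn (by positivity) hA hP hPM hM
    nlinarith
end
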